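/- Let k ≥ 2 and suppose E[ξ^{k+1}] < ∞. Then there exists a constant C > 0 such that for all n ∈ I and all t ≥ 1: the probability under τ_n that max over all nodes v of N_k(v) is at least t is at most C·n·t^{−k/2}. If E[ξ^{(3k+1)/2}] < ∞, the same bound (with a possibly larger constant C) holds with N_k(v) replaced by N_{k+}(v). -/

import Mathlib

/-! Finite ordered rooted (plane) trees: a tree is a finite list of its root subtrees. -/
inductive PTree : Type where
  | node : List PTree → PTree

namespace PTree

/-- the number of nodes of the tree -/
def size : PTree → ℕ
  | node ts => 1 + (ts.attach.map (fun x => size x.1)).sum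
decreasing_by
  have := List.sizeOf_lt_of_mem x.2
  simp only [node.sizeOf_spec]; omega

/-- the list of all subtrees rooted at the nodes of the tree -/
def subtrees : PTree → List PTree
  | node ts => node ts :: (ts.attach.map (fun x => subtrees x.1)).flatten
decreasing_by
  have := List.sizeOf_lt_of_mem x.2
  simp only [node.sizeOf_spec]; omega

/-- the height of the tree (maximal distance from the root to a node) -/
def height : PTree → ℕ
  | node ts => (ts.attach.map (fun x => height x.1 + 1)).foldr max 0
decreasing_by
  have := List.sizeOf_lt_of_mem x.2
  simp only [node.sizeOf_spec]; omega

/-- the number of children of the root (`ξ_ε`) -/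
def rootDeg : PTree → ℕ
  | node ts => ts.length

/-- the sizes of the subtrees rooted at the children of the root -/
def childSizes : PTree → List ℕ
  | node ts => ts.map size

/-- the sizes of the subtrees rooted at the children of the root,
sorted from largest to smallest -/
def sortedSizesDesc (T : PTree) : List ℕ :=
  T.childSizes.insertionSort (· ≥ ·)

/-- `N_k`: the `k`-th largest among the sizes of the subtrees rooted at the children
of the root (`0` if there are fewer than `k` children) -/
def Nk (k : ℕ) (T : PTree) : ℕ := (sortedSizesDesc T).getD (k - 1) 0

/-- `N_{k+} = N_k + N_{k+1} + ⋯` -/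
def NkPlus (k : ℕ) (T : PTree) : ℕ := ((sortedSizesDesc T).drop (k - 1)).sum

/-- the subtrees rooted at the nodes of the heavy path: starting at the root, always
continue to the first child of maximal subtree size -/
def heavyPath : PTree → List PTree
  | node ts =>
    node ts ::
      (match ts.attach.find? (fun x => x.1.size = ((ts.map size).foldr max 0)) with
       | some x => heavyPath x.1
       | none => [])
decreasing_by
  have := List.sizeOf_lt_of_mem x.2
  simp only [node.sizeOf_spec]; omega

end PTree

/-- `Z_k`: the number of nodes `v` of the tree whose subtree has size `k` -/
def Zk (k : ℕ) (T : PTree) : ℕ := (T.subtrees.filter (fun s => s.size = k)).length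

/-- the rank (`1` = largest) of the `i`-th child (0-based) among siblings whose subtree
sizes are given by the list `sizes`; ties are broken from left to right -/
def rankIn (sizes : List ℕ) (i : ℕ) : ℕ :=
  1 + ((List.range sizes.length).filter (fun j =>
        sizes.getD i 0 < sizes.getD j 0 ∨ (sizes.getD j 0 = sizes.getD i 0 ∧ j < i))).length

mutual
/-- the number of nodes of the `k`-heavy tree: the root together with all nodes `v` such
that `v` and every non-root ancestor of `v` has rank at most `k` among its siblings -/
def heavySize (k : ℕ) : PTree → ℕ
  | .node ts => 1 + heavySizeAux k (ts.map PTree.size) 0 ts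
def heavySizeAux (k : ℕ) (sizes : List ℕ) : ℕ → List PTree → ℕ
  | _, [] => 0
  | i, t :: rest =>
      (if rankIn sizes i ≤ k then heavySize k t else 0) + heavySizeAux k sizes (i + 1) rest
end

/-- `H*(v,ℓ)`: the height of the subtree rooted at the child of rank `ℓ` of the root of `v`
(`0` if there are fewer than `ℓ` children) -/
def Hstar : PTree → ℕ → ℕ
  | .node ts, ℓ =>
    match (List.range ts.length).find? (fun i => rankIn (ts.map PTree.size) i = ℓ) with
    | some i => (ts.getD i (.node [])).height
    | none => 0

/-- the weight of a tree: the product over all nodes `v` of `p (number of children of v)` -/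
noncomputable def weight (p : ℕ → ℝ) : PTree → ℝ
  | .node ts => p ts.length * (ts.attach.map (fun x => weight p x.1)).prod
decreasing_by
  have := List.sizeOf_lt_of_mem x.2
  simp only [PTree.node.sizeOf_spec]; omega

/-- the total weight of all trees of size `n` -/
noncomputable def treeSum (p : ℕ → ℝ) (n : ℕ) : ℝ :=
  ∑' T : {T : PTree // T.size = n}, weight p T.1

/-- the probability of the event `A` under the conditional Galton-Watson tree `τ_n` -/
noncomputable def condProb (p : ℕ → ℝ) (n : ℕ) (A : PTree → Prop) : ℝ :=
  (∑' T : {T : PTree // T.size = n ∧ A T}, weight p T.1) / treeSum p n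

/-- the expectation of `f` under the conditional Galton-Watson tree `τ_n` -/
noncomputable def condExp (p : ℕ → ℝ) (n : ℕ) (f : PTree → ℝ) : ℝ :=
  (∑' T : {T : PTree // T.size = n}, weight p T.1 * f T.1) / treeSum p n

/-- the variance of `f` under the conditional Galton-Watson tree `τ_n` -/
noncomputable def condVar (p : ℕ → ℝ) (n : ℕ) (f : PTree → ℝ) : ℝ :=
  condExp p n (fun T => f T ^ 2) - (condExp p n f) ^ 2

/-- the set `I = {n ≥ 1 : Σ_{|T| = n} w(T) > 0}` of sizes of positive probability -/
def gwSupport (p : ℕ → ℝ) : Set ℕ := {n | 1 ≤ n ∧ 0 < treeSum p n}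

/-- `P(S_m = x)` for the random walk `S_m = (ξ_1 - 1) + ⋯ + (ξ_m - 1)`, `ξ_i` i.i.d. `∼ p` -/
noncomputable def walkProb (p : ℕ → ℝ) (m : ℕ) (x : ℤ) : ℝ :=
  ∑' a : Fin m → ℕ, if (∑ i, ((a i : ℤ) - 1)) = x then ∏ i, p (a i) else 0

/-- `I_n = {1 ≤ k ≤ n : P(S_{n-k} = 0) > 0}` -/
def walkSupportIn (p : ℕ → ℝ) (n : ℕ) : Set ℕ :=
  {k | 1 ≤ k ∧ k ≤ n ∧ 0 < walkProb p (n - k) 0}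

/-- `h = gcd {i > 0 : p_i > 0}`, defined as the largest common divisor of the support -/
noncomputable def gcdSupp (p : ℕ → ℝ) : ℕ :=
  sSup {d : ℕ | 0 < d ∧ ∀ i : ℕ, 0 < i → 0 < p i → d ∣ i}

/-- `α = h / (σ √(2π))` where `σ² = Σ i² p_i - 1` -/
noncomputable def gwAlpha (p : ℕ → ℝ) : ℝ :=
  (gcdSupp p : ℝ) /
    (Real.sqrt ((∑' i : ℕ, (i : ℝ) ^ 2 * p i) - 1) * Real.sqrt (2 * Real.pi))

/-- the moment `E[ξ^m] = Σ i^m p_i` is finite -/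
def MomentFinite (p : ℕ → ℝ) (m : ℝ) : Prop :=
  Summable (fun i : ℕ => (i : ℝ) ^ m * p i)

/-- `max_{v ∈ T} N_k(v)` : the maximum of `N_k` over all nodes of the tree -/
def maxNk (k : ℕ) (T : PTree) : ℕ := ((T.subtrees.map (PTree.Nk k)).foldr max 0)

/-- `max_{v ∈ T} N_{k+}(v)` -/
def maxNkPlus (k : ℕ) (T : PTree) : ℕ := ((T.subtrees.map (PTree.NkPlus k)).foldr max 0)

section LocalLimit

open Filter Topology MeasureTheory

/-- the characteristic function `Σ_j p_j e^{ijθ}` of a weight sequence on `ℕ` -/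
noncomputable def seqChar (p : ℕ → ℝ) (θ : ℝ) : ℂ :=
  ∑' j : ℕ, (p j : ℂ) * Complex.exp (((j : ℝ) * θ : ℝ) * Complex.I)


variable {p : ℕ → ℝ}

lemma summable_of_tsum_eq_one (h : ∑' i, p i = 1) : Summable p := by
  by_contra hs
  simp [tsum_eq_zero_of_not_summable hs] at h

lemma norm_exp_ofReal_mul_I_sub_one_sq (x : ℝ) :
    ‖Complex.exp (x * Complex.I) - 1‖ ^ 2 = 2 * (1 - Real.cos x) := by
  rw [← Complex.normSq_eq_norm_sq, Complex.normSq_apply]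
  simp only [Complex.sub_re, Complex.sub_im, Complex.exp_ofReal_mul_I_re,
    Complex.exp_ofReal_mul_I_im, Complex.one_re, Complex.one_im]
  nlinarith [Real.sin_sq_add_cos_sq x]

lemma summable_seqChar_term (h0 : ∀ i, 0 ≤ p i) (hs : Summable p) (θ : ℝ) :
    Summable fun j : ℕ => ‖(p j : ℂ) * Complex.exp (((j : ℝ) * θ : ℝ) * Complex.I)‖ := by
  simpa only [norm_mul, Complex.norm_exp_ofReal_mul_I, mul_one, Complex.norm_real,
    Real.norm_of_nonneg (h0 _)] using hs

lemma hasSum_one_sub_re_seqChar (h0 : ∀ i, 0 ≤ p i) (h1 : ∑' i, p i = 1) (θ : ℝ) :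
    HasSum (fun j : ℕ => p j * (1 - Real.cos (j * θ))) (1 - (seqChar p θ).re) := by
  have hs := summable_of_tsum_eq_one h1
  have h := (summable_seqChar_term h0 hs θ).of_norm.hasSum
  have h' := Complex.hasSum_re h
  have h2 := hs.hasSum
  rw [h1] at h2
  refine (h2.sub h').congr_fun ?_ |> fun h => h
  intro j
  rw [Complex.re_ofReal_mul, Complex.exp_ofReal_mul_I_re]
  ring

lemma norm_seqChar_sq_le (h0 : ∀ i, 0 ≤ p i) (h1 : ∑' i, p i = 1) (θ : ℝ) :
    ‖seqChar p θ‖ ^ 2 ≤ 1 - 2 * p 0 * (1 - (seqChar p θ).re) := by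
  have hs := summable_of_tsum_eq_one h1
  have hn := summable_seqChar_term h0 hs θ
  have hsplit : seqChar p θ = p 0 +
      ∑' j : ℕ, (p (j + 1) : ℂ) * Complex.exp ((((j + 1 : ℕ) : ℝ) * θ : ℝ) * Complex.I) := by
    rw [seqChar, hn.of_norm.tsum_eq_zero_add]
    simp
  set B := ∑' j : ℕ, (p (j + 1) : ℂ) * Complex.exp ((((j + 1 : ℕ) : ℝ) * θ : ℝ) * Complex.I)
  have hB : ‖B‖ ≤ 1 - p 0 := by
    have hn' := (summable_nat_add_iff 1).2 hn
    refine (norm_tsum_le_tsum_norm hn').trans (le_of_eq ?_)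
    rw [hs.tsum_eq_zero_add] at h1
    simp only [norm_mul, Complex.norm_exp_ofReal_mul_I, mul_one, Complex.norm_real,
      Real.norm_of_nonneg (h0 _)]
    linarith
  have hB2 : ‖B‖ ^ 2 ≤ (1 - p 0) ^ 2 := pow_le_pow_left₀ (norm_nonneg _) hB 2
  rw [← Complex.normSq_eq_norm_sq, Complex.normSq_apply] at hB2 ⊢
  rw [hsplit]
  simp only [Complex.add_re, Complex.add_im, Complex.ofReal_re, Complex.ofReal_im]
  nlinarith

/-- The exponents controlled by `1 - Re φ` form a subgroup of `ℤ`. -/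
lemma exists_span (h0 : ∀ i, 0 ≤ p i) (h1 : ∑' i, p i = 1) {i₀ : ℕ} (hi₀ : i₀ ≠ 0)
    (hpi₀ : p i₀ ≠ 0) :
    ∃ d : ℕ, 0 < d ∧ (∀ j, p j ≠ 0 → d ∣ j) ∧ ∃ C : ℝ, 0 < C ∧ ∀ θ : ℝ,
      1 - Real.cos (d * θ) ≤ C * (1 - (seqChar p θ).re) := by
  have hnn : ∀ θ, 0 ≤ 1 - (seqChar p θ).re := fun θ =>
    (hasSum_one_sub_re_seqChar h0 h1 θ).nonneg fun j =>
      mul_nonneg (h0 j) (by linarith [Real.cos_le_one (j * θ)])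
  let G : AddSubgroup ℤ :=
    { carrier := {a | ∃ C : ℝ, 0 < C ∧ ∀ θ : ℝ,
        ‖Complex.exp ((a * θ : ℝ) * Complex.I) - 1‖ ^ 2 ≤ C * (1 - (seqChar p θ).re)}
      zero_mem' := ⟨1, one_pos, fun θ => by simpa using hnn θ⟩
      add_mem' := by
        rintro a b ⟨C, hC, ha⟩ ⟨D, hD, hb⟩
        refine ⟨2 * C + 2 * D, by positivity, fun θ => ?_⟩
        have e : Complex.exp ((((a + b : ℤ) : ℝ) * θ : ℝ) * Complex.I) - 1 =
            Complex.exp ((a * θ : ℝ) * Complex.I) *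
              (Complex.exp ((b * θ : ℝ) * Complex.I) - 1) +
              (Complex.exp ((a * θ : ℝ) * Complex.I) - 1) := by
          rw [mul_sub, ← Complex.exp_add]
          push_cast
          ring_nf
        have hle := norm_add_le (Complex.exp ((a * θ : ℝ) * Complex.I) *
              (Complex.exp ((b * θ : ℝ) * Complex.I) - 1))
              (Complex.exp ((a * θ : ℝ) * Complex.I) - 1)
        rw [← e, norm_mul, Complex.norm_exp_ofReal_mul_I, one_mul] at hle
        have := ha θ
        have := hb θ
        have h2 := pow_le_pow_left₀ (norm_nonneg _) hle 2
        nlinarith [sq_nonneg (‖Complex.exp ((a * θ : ℝ) * Complex.I) - 1‖ -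
          ‖Complex.exp ((b * θ : ℝ) * Complex.I) - 1‖)]
      neg_mem' := by
        rintro a ⟨C, hC, ha⟩
        refine ⟨C, hC, fun θ => ?_⟩
        have := ha θ
        rw [norm_exp_ofReal_mul_I_sub_one_sq] at this ⊢
        simpa using this }
  have hG : ∀ j : ℕ, p j ≠ 0 → (j : ℤ) ∈ G := by
    intro j hj
    have hpos : 0 < p j := lt_of_le_of_ne (h0 j) hj.symm
    refine ⟨2 / p j, by positivity, fun θ => ?_⟩
    rw [norm_exp_ofReal_mul_I_sub_one_sq, Int.cast_natCast]
    have := le_hasSum (hasSum_one_sub_re_seqChar h0 h1 θ) j fun i _ =>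
      mul_nonneg (h0 i) (by linarith [Real.cos_le_one (i * θ)])
    rw [div_mul_eq_mul_div, le_div_iff₀ hpos]
    linarith
  obtain ⟨a, ha⟩ := Int.subgroup_cyclic G
  have hdvd : ∀ j : ℕ, p j ≠ 0 → a.natAbs ∣ j := by
    intro j hj
    have := hG j hj
    rw [ha, AddSubgroup.mem_closure_singleton] at this
    obtain ⟨n, hn⟩ := this
    rw [← Int.natCast_dvd_natCast, Int.natAbs_dvd]
    exact ⟨n, by rw [← hn, smul_eq_mul, mul_comm]⟩
  refine ⟨a.natAbs, ?_, hdvd, ?_⟩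
  · rcases Nat.eq_zero_or_pos a.natAbs with h | h
    · have := hdvd i₀ hpi₀
      rw [h, zero_dvd_iff] at this
      exact absurd this hi₀
    · exact h
  · have hmem : a ∈ G := by rw [ha]; exact AddSubgroup.subset_closure rfl
    obtain ⟨C, hC, h⟩ := hmem
    refine ⟨C, hC, fun θ => ?_⟩
    have h2 := h θ
    rw [norm_exp_ofReal_mul_I_sub_one_sq] at h2
    have h3 : Real.cos ((a.natAbs : ℝ) * θ) = Real.cos (a * θ) := by
      have h4 : ((a.natAbs : ℕ) : ℝ) = |(a : ℝ)| := by
        rw [Nat.cast_natAbs, Int.cast_abs]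
      rw [h4]
      rcases abs_choice (a : ℝ) with h | h <;> simp [h]
    rw [h3]
    linarith [Real.cos_le_one (a * θ)]

lemma two_div_pi_sq_mul_sq_le {x : ℝ} (hx : |x| ≤ Real.pi) :
    2 / Real.pi ^ 2 * x ^ 2 ≤ 1 - Real.cos x := by
  linarith [Real.cos_le_one_sub_mul_cos_sq hx]

lemma exists_norm_seqChar_le (h0 : ∀ i, 0 ≤ p i) (h1 : ∑' i, p i = 1) (hp0 : p 0 ≠ 0)
    {i₀ : ℕ} (hi₀ : i₀ ≠ 0) (hpi₀ : p i₀ ≠ 0) :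
    ∃ d : ℕ, 0 < d ∧ (∀ j, p j ≠ 0 → d ∣ j) ∧ ∃ c : ℝ, 0 < c ∧ ∀ θ : ℝ, |θ| ≤ Real.pi / d →
      ‖seqChar p θ‖ ≤ Real.exp (-c * θ ^ 2) := by
  obtain ⟨d, hd, hdvd, C, hC, h⟩ := exists_span h0 h1 hi₀ hpi₀
  have hd' : (0 : ℝ) < d := by exact_mod_cast hd
  have hp0' : 0 < p 0 := lt_of_le_of_ne (h0 0) hp0.symm
  have hpi := Real.pi_pos
  refine ⟨d, hd, hdvd, p 0 * (2 / Real.pi ^ 2 * d ^ 2 / C), by positivity, fun θ hθ => ?_⟩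
  have hx : |(d : ℝ) * θ| ≤ Real.pi := by
    rw [abs_mul, abs_of_pos hd', mul_comm]
    rwa [le_div_iff₀ hd'] at hθ
  have h2 : 2 / Real.pi ^ 2 * d ^ 2 / C * θ ^ 2 ≤ 1 - (seqChar p θ).re := by
    rw [div_mul_eq_mul_div, div_le_iff₀ hC]
    have := two_div_pi_sq_mul_sq_le hx
    have := h θ
    nlinarith
  have h3 := norm_seqChar_sq_le h0 h1 θ
  have h4 : ‖seqChar p θ‖ ^ 2 ≤ Real.exp (-(p 0 * (2 / Real.pi ^ 2 * d ^ 2 / C)) * θ ^ 2) ^ 2 := by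
    rw [← Real.exp_nat_mul]
    refine h3.trans ((?_ : _ ≤ _).trans (Real.add_one_le_exp _))
    push_cast
    nlinarith
  exact (pow_le_pow_iff_left₀ (norm_nonneg _) (Real.exp_pos _).le two_ne_zero).1 h4

lemma norm_exp_mul_I_sub_one_sub_le (x : ℝ) :
    ‖Complex.exp (x * Complex.I) - 1 - x * Complex.I‖ ≤ 3 * x ^ 2 := by
  rcases le_or_gt |x| 1 with h | h
  · have := Complex.norm_exp_sub_one_sub_id_le (x := x * Complex.I) (by simpa using h)
    refine this.trans ?_
    simp
    nlinarith [sq_nonneg x]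
  · have h1 : ‖Complex.exp (x * Complex.I) - 1 - x * Complex.I‖ ≤ 1 + 1 + |x| := by
      refine (norm_sub_le _ _).trans (add_le_add ((norm_sub_le _ _).trans ?_) ?_) <;> simp
    refine h1.trans ?_
    rw [← sq_abs]
    nlinarith

lemma tendsto_mul_exp_sub (y : ℝ) :
    Tendsto (fun m : ℕ => (m : ℂ) * (Complex.exp ((y / √m : ℝ) * Complex.I) - 1 -
      (y / √m : ℝ) * Complex.I)) atTop (𝓝 (-(y ^ 2) / 2)) := by
  have hlim : Tendsto (fun m : ℕ => |y| / √(m : ℝ)) atTop (𝓝 0) :=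
    tendsto_const_nhds.div_atTop (Real.tendsto_sqrt_atTop.comp tendsto_natCast_atTop_atTop)
  have hlim2 : Tendsto (fun m : ℕ => y ^ 2 * (|y| / √(m : ℝ))) atTop (𝓝 0) := by
    simpa using hlim.const_mul (y ^ 2)
  rw [tendsto_iff_norm_sub_tendsto_zero]
  refine squeeze_zero' (Eventually.of_forall fun _ => norm_nonneg _) ?_ hlim2
  filter_upwards [hlim.eventually (eventually_le_nhds one_pos), eventually_gt_atTop 0]
    with m hm hm0
  have hmpos : (0 : ℝ) < m := by exact_mod_cast hm0
  have hsq : √(m : ℝ) ^ 2 = m := Real.sq_sqrt hmpos.le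
  have hs : 0 < √(m : ℝ) := Real.sqrt_pos.2 hmpos
  have habs : |y / √(m : ℝ)| = |y| / √m := by rw [abs_div, abs_of_pos hs]
  have hz : ‖((y / √m : ℝ) : ℂ) * Complex.I‖ = |y| / √m := by
    rw [norm_mul, Complex.norm_I, mul_one, Complex.norm_real, Real.norm_eq_abs, habs]
  have hb := Complex.exp_bound (x := (y / √m : ℝ) * Complex.I) (hz.trans_le hm) (n := 3)
    (by norm_num)
  rw [hz] at hb
  have hkey : (m : ℂ) * (((y / √m : ℝ) : ℂ) * Complex.I) ^ 2 = -(y ^ 2) := by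
    rw [mul_pow, Complex.I_sq, ← Complex.ofReal_pow, div_pow, hsq]
    have hm' : (m : ℂ) ≠ 0 := by exact_mod_cast hm0.ne'
    push_cast
    rw [mul_neg_one, mul_neg, mul_div_cancel₀ _ hm']
  have hrw : (m : ℂ) * (Complex.exp ((y / √m : ℝ) * Complex.I) - 1 -
      (y / √m : ℝ) * Complex.I) - -(y ^ 2) / 2 = m * (Complex.exp ((y / √m : ℝ) * Complex.I) -
        ∑ i ∈ Finset.range 3, (((y / √m : ℝ) : ℂ) * Complex.I) ^ i / i.factorial) := by
    rw [← hkey]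
    simp only [Finset.sum_range_succ, Finset.sum_range_zero, pow_zero, pow_one, Nat.factorial]
    push_cast
    ring
  rw [hrw, norm_mul, Complex.norm_natCast]
  calc (m : ℝ) * _ ≤ m * ((|y| / √m) ^ 3 * 1) := by
        gcongr
        refine hb.trans ?_
        gcongr
        norm_num [Nat.factorial]
    _ = y ^ 2 * (|y| / √m) := by
        rw [← sq_abs y]
        have : (|y| / √(m : ℝ)) ^ 3 = |y| ^ 2 / m * (|y| / √m) := by
          rw [pow_succ, div_pow, hsq]
        rw [this]
        field_simp

lemma summable_mean (h0 : ∀ i, 0 ≤ p i) (hs : Summable p)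
    (hsq : Summable fun i : ℕ => (i : ℝ) ^ 2 * p i) : Summable fun i : ℕ => (i : ℝ) * p i := by
  refine Summable.of_nonneg_of_le (fun i => mul_nonneg i.cast_nonneg (h0 i)) (fun i => ?_)
    (hs.add hsq)
  nlinarith [h0 i, mul_nonneg (h0 i) (sq_nonneg ((i : ℝ) - 1)), mul_nonneg (h0 i) (sq_nonneg ((i : ℝ)))]

lemma tendsto_seqChar_pow (h0 : ∀ i, 0 ≤ p i) (h1 : ∑' i, p i = 1)
    (hmean : ∑' i : ℕ, (i : ℝ) * p i = 1) (hsq : Summable fun i : ℕ => (i : ℝ) ^ 2 * p i)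
    (u : ℝ) :
    Tendsto (fun m : ℕ => (Complex.exp ((-(u / √m) : ℝ) * Complex.I) * seqChar p (u / √m)) ^ m)
      atTop (𝓝 (Complex.exp (-(((∑' i : ℕ, (i : ℝ) ^ 2 * p i) - 1) * u ^ 2 / 2 : ℝ)))) := by
  have hs := summable_of_tsum_eq_one h1
  have hm := summable_mean h0 hs hsq
  set q := ∑' i : ℕ, (i : ℝ) ^ 2 * p i
  have hqs : HasSum (fun j : ℕ => p j * ((j : ℝ) - 1) ^ 2) (q - 1) := by
    have h := (hsq.hasSum.sub (hm.hasSum.mul_left 2)).add hs.hasSum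
    rw [hmean, h1] at h
    have h' : HasSum (fun j : ℕ => p j * ((j : ℝ) - 1) ^ 2) (q - 2 * 1 + 1) :=
      h.congr_fun fun j => by ring
    convert h' using 1
    ring
  have hcent : HasSum (fun j : ℕ => p j * ((j : ℝ) - 1)) 0 := by
    have h := hm.hasSum.sub hs.hasSum
    rw [hmean, h1, sub_self] at h
    exact h.congr_fun fun j => by ring
  have hterm : ∀ m : ℕ, (m : ℂ) * (Complex.exp ((-(u / √m) : ℝ) * Complex.I) *
      seqChar p (u / √m) - 1) = ∑' j : ℕ, (p j : ℂ) * ((m : ℂ) *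
        (Complex.exp (((((j : ℝ) - 1) * u) / √m : ℝ) * Complex.I) - 1 -
          ((((j : ℝ) - 1) * u) / √m : ℝ) * Complex.I)) := by
    intro m
    have hA := ((summable_seqChar_term h0 hs (u / √m)).of_norm.hasSum).mul_left
      (Complex.exp ((-(u / √m) : ℝ) * Complex.I))
    have hB := Complex.hasSum_ofReal.2 hs.hasSum
    rw [h1] at hB
    have hC := (Complex.hasSum_ofReal.2 hcent).mul_right (((u / √m : ℝ) : ℂ) * Complex.I)
    have h := ((hA.sub hB).sub hC).mul_left (m : ℂ)
    rw [Complex.ofReal_zero, zero_mul, sub_zero, Complex.ofReal_one] at h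
    refine Eq.symm (HasSum.tsum_eq ?_)
    refine h.congr_fun fun j => ?_
    have he : Complex.exp (((((j : ℝ) - 1) * u) / √m : ℝ) * Complex.I) =
        Complex.exp ((-(u / √m) : ℝ) * Complex.I) *
          Complex.exp (((j : ℝ) * (u / √m) : ℝ) * Complex.I) := by
      rw [← Complex.exp_add]
      congr 1
      push_cast
      ring
    rw [he]
    push_cast
    ring
  have hlim : Tendsto (fun m : ℕ => (m : ℂ) * (Complex.exp ((-(u / √m) : ℝ) * Complex.I) *
      seqChar p (u / √m) - 1)) atTop (𝓝 (-((q - 1) * u ^ 2 / 2 : ℝ))) := by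
    simp_rw [hterm]
    have hval : (-((q - 1) * u ^ 2 / 2 : ℝ) : ℂ) =
        ∑' j : ℕ, (p j : ℂ) * (-((((j : ℝ) - 1) * u : ℝ) : ℂ) ^ 2 / 2) := by
      have h := (Complex.hasSum_ofReal.2 hqs).mul_right (-(u : ℂ) ^ 2 / 2)
      have h' : HasSum (fun j : ℕ => (p j : ℂ) * (-((((j : ℝ) - 1) * u : ℝ) : ℂ) ^ 2 / 2)) _ :=
        h.congr_fun fun j => by push_cast; ring
      rw [h'.tsum_eq]
      push_cast
      ring
    rw [hval]
    refine tendsto_tsum_of_dominated_convergence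
      (bound := fun j : ℕ => p j * ((j : ℝ) - 1) ^ 2 * (3 * u ^ 2)) (hqs.summable.mul_right _)
      (fun j => (tendsto_mul_exp_sub _).const_mul _) (Eventually.of_forall fun m j => ?_)
    rw [norm_mul, norm_mul, Complex.norm_real, Real.norm_of_nonneg (h0 j), Complex.norm_natCast,
      mul_assoc]
    refine mul_le_mul_of_nonneg_left ?_ (h0 j)
    refine (mul_le_mul_of_nonneg_left (norm_exp_mul_I_sub_one_sub_le _) m.cast_nonneg).trans ?_
    rcases m.eq_zero_or_pos with rfl | hm0
    · simp; positivity
    · have hmpos : (0 : ℝ) < m := by exact_mod_cast hm0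
      rw [div_pow, Real.sq_sqrt hmpos.le]
      apply le_of_eq
      field_simp
  have h := Complex.tendsto_one_add_pow_exp_of_tendsto hlim
  simpa only [add_sub_cancel] using h

lemma continuous_seqChar (h0 : ∀ i, 0 ≤ p i) (hs : Summable p) : Continuous (seqChar p) := by
  refine continuous_tsum (fun j => by fun_prop) hs fun j θ => ?_
  rw [norm_mul, Complex.norm_exp_ofReal_mul_I, mul_one, Complex.norm_real,
    Real.norm_of_nonneg (h0 j)]

lemma coeff_mk_pow_nonneg (h0 : ∀ i, 0 ≤ p i) (m r : ℕ) :
    0 ≤ PowerSeries.coeff r (PowerSeries.mk p ^ m) := by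
  induction m generalizing r with
  | zero => rw [pow_zero, PowerSeries.coeff_one]; split_ifs <;> norm_num
  | succ m ih =>
    rw [pow_succ, PowerSeries.coeff_mul]
    exact Finset.sum_nonneg fun x _ => mul_nonneg (ih _) (by simpa using h0 _)

lemma dvd_of_coeff_mk_pow_ne_zero {d : ℕ} (hd : ∀ j, p j ≠ 0 → d ∣ j) (m r : ℕ)
    (h : PowerSeries.coeff r (PowerSeries.mk p ^ m) ≠ 0) : d ∣ r := by
  induction m generalizing r with
  | zero =>
    rw [pow_zero, PowerSeries.coeff_one] at h
    split_ifs at h with hr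
    · simp [hr]
    · exact absurd rfl h
  | succ m ih =>
    rw [pow_succ, PowerSeries.coeff_mul] at h
    obtain ⟨x, hx, hne⟩ := Finset.exists_ne_zero_of_sum_ne_zero h
    rw [← Finset.HasAntidiagonal.mem_antidiagonal.1 hx]
    exact dvd_add (ih _ (left_ne_zero_of_mul hne))
      (hd _ (by simpa using right_ne_zero_of_mul hne))

lemma seqChar_pow (h0 : ∀ i, 0 ≤ p i) (hs : Summable p) (m : ℕ) :
    Summable (fun r => PowerSeries.coeff r (PowerSeries.mk p ^ m)) ∧
      ∀ θ, seqChar (fun r => PowerSeries.coeff r (PowerSeries.mk p ^ m)) θ = seqChar p θ ^ m := by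
  induction m with
  | zero =>
    refine ⟨summable_of_ne_finset_zero (s := {0}) fun r hr => ?_, fun θ => ?_⟩
    · rw [pow_zero, PowerSeries.coeff_one, if_neg (by simpa using hr)]
    · rw [seqChar, tsum_eq_single 0 fun r hr => ?_]
      · simp
      · simp [PowerSeries.coeff_one, hr]
  | succ m ih =>
    have hn := fun r => coeff_mk_pow_nonneg h0 m r
    have hsm : Summable (fun r => PowerSeries.coeff r (PowerSeries.mk p ^ (m + 1))) := by
      have h := summable_norm_sum_mul_antidiagonal_of_summable_norm (R := ℝ) ih.1.norm hs.norm
      refine h.of_norm.congr fun r => ?_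
      rw [pow_succ, PowerSeries.coeff_mul]
      simp
    refine ⟨hsm, fun θ => ?_⟩
    rw [pow_succ (seqChar p θ), ← ih.2 θ, seqChar, seqChar, seqChar,
      tsum_mul_tsum_eq_tsum_sum_antidiagonal_of_summable_norm
        (summable_seqChar_term hn ih.1 θ) (summable_seqChar_term h0 hs θ)]
    refine tsum_congr fun r => ?_
    rw [pow_succ, PowerSeries.coeff_mul, Complex.ofReal_sum, Finset.sum_mul]
    refine Finset.sum_congr rfl fun x hx => ?_
    have he : Complex.exp (((r : ℝ) * θ : ℝ) * Complex.I) =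
        Complex.exp (((x.1 : ℝ) * θ : ℝ) * Complex.I) *
          Complex.exp (((x.2 : ℝ) * θ : ℝ) * Complex.I) := by
      rw [← Complex.exp_add, ← Finset.HasAntidiagonal.mem_antidiagonal.1 hx]
      congr 1
      push_cast
      ring
    rw [he, PowerSeries.coeff_mk]
    push_cast
    ring

lemma integral_exp_int_mul {d : ℕ} (hd : 0 < d) (s : ℤ) :
    ∫ θ in (-(Real.pi / d))..(Real.pi / d), Complex.exp (((d * s : ℝ) * θ : ℝ) * Complex.I) =
      if s = 0 then ((2 * Real.pi / d : ℝ) : ℂ) else 0 := by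
  have hd' : (d : ℂ) ≠ 0 := by exact_mod_cast hd.ne'
  split_ifs with h
  · subst h
    simp only [Int.cast_zero, mul_zero, zero_mul, Complex.ofReal_zero, Complex.exp_zero,
      intervalIntegral.integral_const]
    rw [Complex.real_smul, mul_one]
    congr 1
    ring
  · have hs : (s : ℂ) ≠ 0 := by exact_mod_cast h
    have hc : (d * s * Complex.I : ℂ) ≠ 0 := mul_ne_zero (mul_ne_zero hd' hs) Complex.I_ne_zero
    have := integral_exp_mul_complex (a := -(Real.pi / d)) (b := Real.pi / d) hc
    have he : ∀ θ : ℝ, Complex.exp (((d * s : ℝ) * θ : ℝ) * Complex.I) =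
        Complex.exp (d * s * Complex.I * θ) := fun θ => by
      congr 1; push_cast; ring
    simp_rw [he]
    rw [this]
    have e1 : (d * s * Complex.I * ((Real.pi / d : ℝ) : ℂ) : ℂ) =
        d * s * Complex.I * ((-(Real.pi / d) : ℝ) : ℂ) + s * (2 * Real.pi * Complex.I) := by
      push_cast
      field_simp
      ring
    rw [e1, Complex.exp_periodic.int_mul s, sub_self, zero_div]

lemma coeff_eq_integral (h0 : ∀ i, 0 ≤ p i) (hs : Summable p) {d : ℕ} (hd : 0 < d)
    (hdvd : ∀ j, p j ≠ 0 → d ∣ j) (m r₀ : ℕ) (hr₀ : d ∣ r₀) :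
    ∫ θ in (-(Real.pi / d))..(Real.pi / d),
      seqChar p θ ^ m * Complex.exp ((-(r₀ * θ) : ℝ) * Complex.I) =
    ((PowerSeries.coeff r₀ (PowerSeries.mk p ^ m) * (2 * Real.pi / d) : ℝ) : ℂ) := by
  obtain ⟨hsm, hpow⟩ := seqChar_pow h0 hs m
  set a : ℕ → ℝ := fun r => PowerSeries.coeff r (PowerSeries.mk p ^ m) with ha
  have hn : ∀ r, 0 ≤ a r := fun r => coeff_mk_pow_nonneg h0 m r
  have h := intervalIntegral.hasSum_integral_of_dominated_convergence (ι := ℕ)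
    (μ := volume) (a := -(Real.pi / d)) (b := Real.pi / d)
    (F := fun r θ => (a r : ℂ) * Complex.exp (((r : ℝ) * θ : ℝ) * Complex.I) *
      Complex.exp ((-(r₀ * θ) : ℝ) * Complex.I))
    (f := fun θ => seqChar p θ ^ m * Complex.exp ((-(r₀ * θ) : ℝ) * Complex.I))
    (fun r _ => a r) (fun r => by fun_prop)
    (fun r => Eventually.of_forall fun θ _ => by
      rw [norm_mul, norm_mul, Complex.norm_exp_ofReal_mul_I, Complex.norm_exp_ofReal_mul_I,
        Complex.norm_real, Real.norm_of_nonneg (hn r), mul_one, mul_one])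
    (Eventually.of_forall fun _ _ => hsm) (by simp)
    (Eventually.of_forall fun θ _ => by
      rw [← hpow θ]
      exact ((summable_seqChar_term hn hsm θ).of_norm.hasSum).mul_right _)
  rw [← h.tsum_eq, tsum_eq_single r₀]
  · have := integral_exp_int_mul hd 0
    rw [if_pos rfl] at this
    rw [Complex.ofReal_mul, ← this, ← intervalIntegral.integral_const_mul]
    refine intervalIntegral.integral_congr fun θ _ => ?_
    rw [mul_assoc, ← Complex.exp_add]
    congr 2
    push_cast
    ring
  · intro r hr
    by_cases hz : a r = 0
    · simp [hz]
    · obtain ⟨x, rfl⟩ := dvd_of_coeff_mk_pow_ne_zero hdvd m r hz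
      obtain ⟨y, rfl⟩ := hr₀
      have := integral_exp_int_mul hd ((x : ℤ) - y)
      rw [if_neg (fun h => hr (by have : x = y := by omega
                                  rw [this]))] at this
      rw [← mul_zero (a (d * x) : ℂ), ← this, ← intervalIntegral.integral_const_mul]
      refine intervalIntegral.integral_congr fun θ _ => ?_
      rw [mul_assoc, ← Complex.exp_add]
      congr 2
      push_cast
      ring

/-- Local limit bounds for the powers of a critical offspring generating function. -/
theorem local_limit_bounds (h0 : ∀ i, 0 ≤ p i) (h1 : ∑' i, p i = 1)
    (hmean : ∑' i : ℕ, (i : ℝ) * p i = 1) (hsq : Summable fun i : ℕ => (i : ℝ) ^ 2 * p i)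
    (hvar : 1 < ∑' i : ℕ, (i : ℝ) ^ 2 * p i) (hp0 : p 0 ≠ 0) :
    (∃ C : ℝ, 0 < C ∧ ∀ m r : ℕ, PowerSeries.coeff r (PowerSeries.mk p ^ m) * √m ≤ C) ∧
    ∃ c : ℝ, 0 < c ∧ ∀ m : ℕ, 0 < PowerSeries.coeff m (PowerSeries.mk p ^ (m + 1)) →
      c ≤ PowerSeries.coeff m (PowerSeries.mk p ^ (m + 1)) * √(m + 1 : ℕ) := by
  have hs := summable_of_tsum_eq_one h1
  have hpi := Real.pi_pos
  obtain ⟨i₀, hi₀, hpi₀⟩ : ∃ i₀ : ℕ, i₀ ≠ 0 ∧ p i₀ ≠ 0 := by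
    by_contra! h
    have hz : (fun i : ℕ => (i : ℝ) * p i) = fun _ => 0 := by
      ext i
      rcases eq_or_ne i 0 with rfl | hi
      · simp
      · simp [h i hi]
    rw [hz] at hmean
    simp at hmean
  obtain ⟨d, hd, hdvd, c, hc, hφ⟩ := exists_norm_seqChar_le h0 h1 hp0 hi₀ hpi₀
  have hd' : (0 : ℝ) < d := by exact_mod_cast hd
  have hab : -(Real.pi / d) ≤ Real.pi / d := by
    have : 0 < Real.pi / d := by positivity
    linarith
  have hcont := continuous_seqChar h0 hs
  constructor
  · refine ⟨√(Real.pi / c) / (2 * Real.pi / d), by positivity, fun m r => ?_⟩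
    by_cases hdr : d ∣ r
    swap
    · have : PowerSeries.coeff r (PowerSeries.mk p ^ m) = 0 := by
        by_contra h
        exact hdr (dvd_of_coeff_mk_pow_ne_zero hdvd m r h)
      rw [this, zero_mul]
      positivity
    rcases m.eq_zero_or_pos with rfl | hm
    · simp; positivity
    have hm' : (0 : ℝ) < m := by exact_mod_cast hm
    have h := coeff_eq_integral h0 hs hd hdvd m r hdr
    have h2 := intervalIntegral.norm_integral_le_of_norm_le hab
      (f := fun θ => seqChar p θ ^ m * Complex.exp ((-(r * θ) : ℝ) * Complex.I))
      (g := fun θ => Real.exp (-(c * m) * θ ^ 2)) (μ := volume)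
      (Eventually.of_forall fun θ hθ => by
        rw [norm_mul, Complex.norm_exp_ofReal_mul_I, mul_one, norm_pow]
        refine (pow_le_pow_left₀ (norm_nonneg _) (hφ θ ?_) m).trans (le_of_eq ?_)
        · exact abs_le.2 ⟨hθ.1.le, hθ.2⟩
        · rw [← Real.exp_nat_mul]
          ring_nf)
      (by apply Continuous.intervalIntegrable; fun_prop)
    rw [h, Complex.norm_real, Real.norm_of_nonneg
      (mul_nonneg (coeff_mk_pow_nonneg h0 m r) (by positivity)),
      intervalIntegral.integral_of_le hab] at h2
    have h3 : ∫ θ in Set.Ioc (-(Real.pi / d)) (Real.pi / d), Real.exp (-(c * m) * θ ^ 2) ≤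
        √(Real.pi / (c * m)) := by
      rw [← integral_gaussian]
      exact setIntegral_le_integral (integrable_exp_neg_mul_sq (by positivity))
        (Eventually.of_forall fun θ => (Real.exp_pos _).le)
    rw [le_div_iff₀ (by positivity)]
    have h4 : √(Real.pi / c) = √(Real.pi / (c * m)) * √m := by
      rw [← Real.sqrt_mul (by positivity)]
      congr 1
      field_simp
    rw [h4]
    have := mul_le_mul_of_nonneg_right (h2.trans h3) (Real.sqrt_nonneg (m : ℝ))
    linarith
  · set q := ∑' i : ℕ, (i : ℝ) ^ 2 * p i
    set a : ℕ → ℝ := fun m => PowerSeries.coeff m (PowerSeries.mk p ^ (m + 1)) * √(m + 1 : ℕ)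
      with ha
    set F : ℕ → ℝ → ℂ := fun m u => Set.indicator (Set.Ioc (-(Real.pi / d * √m)) (Real.pi / d * √m))
      (fun u : ℝ => (Complex.exp ((-(u / √m) : ℝ) * Complex.I) * seqChar p (u / √m)) ^ m *
        Complex.exp ((u / √m : ℝ) * Complex.I)) u with hF
    have hlim : Tendsto (fun m => ∫ u, F m u) atTop
        (𝓝 (∫ u : ℝ, Complex.exp (-((q - 1) * u ^ 2 / 2 : ℝ)))) := by
      refine tendsto_integral_of_dominated_convergence (fun u => Real.exp (-c * u ^ 2)) (fun m => ?_)
        (integrable_exp_neg_mul_sq hc) (fun m => Eventually.of_forall fun u => ?_)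
        (Eventually.of_forall fun u => ?_)
      · refine (Continuous.aestronglyMeasurable ?_).indicator measurableSet_Ioc
        have : Continuous fun u : ℝ => seqChar p (u / √m) := hcont.comp (by fun_prop)
        fun_prop
      · by_cases hu : u ∈ Set.Ioc (-(Real.pi / d * √m)) (Real.pi / d * √m)
        swap
        · simp only [hF, Set.indicator_of_notMem hu, norm_zero]
          positivity
        · simp only [hF, Set.indicator_of_mem hu]
          rw [norm_mul, Complex.norm_exp_ofReal_mul_I, mul_one, norm_pow, norm_mul,
            Complex.norm_exp_ofReal_mul_I, one_mul]
          rcases m.eq_zero_or_pos with rfl | hm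
          · exfalso
            simp at hu
          have hm' : (0 : ℝ) < m := by exact_mod_cast hm
          have hsm : 0 < √(m : ℝ) := Real.sqrt_pos.2 hm'
          refine (pow_le_pow_left₀ (norm_nonneg _) (hφ _ ?_) m).trans (le_of_eq ?_)
          · rw [abs_div, abs_of_pos hsm, div_le_iff₀ hsm]
            exact abs_le.2 ⟨hu.1.le, hu.2⟩
          · rw [← Real.exp_nat_mul, div_pow, Real.sq_sqrt hm'.le]
            congr 1
            field_simp
      · have hz : Tendsto (fun m : ℕ => √(m : ℝ)) atTop atTop :=
          Real.tendsto_sqrt_atTop.comp tendsto_natCast_atTop_atTop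
        have h2 : Tendsto (fun m : ℕ => Complex.exp ((u / √m : ℝ) * Complex.I)) atTop (𝓝 1) := by
          have : Tendsto (fun m : ℕ => u / √(m : ℝ)) atTop (𝓝 0) := tendsto_const_nhds.div_atTop hz
          have hc : Continuous fun x : ℝ => Complex.exp ((x : ℝ) * Complex.I) := by fun_prop
          have h := (hc.tendsto 0).comp this
          rw [Complex.ofReal_zero, zero_mul, Complex.exp_zero] at h
          exact h
        have h3 := (tendsto_seqChar_pow h0 h1 hmean hsq u).mul h2
        rw [mul_one] at h3
        refine h3.congr' ?_
        have h4 : Tendsto (fun m : ℕ => Real.pi / d * √(m : ℝ)) atTop atTop :=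
          hz.const_mul_atTop (by positivity)
        filter_upwards [h4.eventually_gt_atTop |u|] with m hm
        have hu : u ∈ Set.Ioc (-(Real.pi / d * √m)) (Real.pi / d * √m) :=
          ⟨(abs_lt.1 hm).1, (abs_lt.1 hm).2.le⟩
        simp only [hF, Set.indicator_of_mem hu]
    have hgauss : ∫ u : ℝ, Complex.exp (-((q - 1) * u ^ 2 / 2 : ℝ)) =
        ((√(Real.pi / ((q - 1) / 2)) : ℝ) : ℂ) := by
      rw [← integral_gaussian, ← integral_complex_ofReal]
      congr 1
      ext u
      rw [← Complex.ofReal_neg, ← Complex.ofReal_exp]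
      congr 2
      ring
    have hL : 0 < √(Real.pi / ((q - 1) / 2)) := by
      have : 0 < q - 1 := by linarith
      positivity
    set L := √(Real.pi / ((q - 1) / 2))
    rw [hgauss] at hlim
    have hre : Tendsto (fun m => (∫ u, F m u).re) atTop (𝓝 L) :=
      (Complex.continuous_re.tendsto _).comp hlim
    have hFa : ∀ m : ℕ, d ∣ m → (∫ u, F (m + 1) u).re = a m * (2 * Real.pi / d) := by
      intro m hm
      have hm' : (0 : ℝ) < (m + 1 : ℕ) := by positivity
      have hsm : √((m + 1 : ℕ) : ℝ) ≠ 0 := (Real.sqrt_pos.2 hm').ne'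
      have h := coeff_eq_integral h0 hs hd hdvd (m + 1) m hm
      have hle : -(Real.pi / d * √((m + 1 : ℕ) : ℝ)) ≤ Real.pi / d * √((m + 1 : ℕ) : ℝ) := by
        have : 0 ≤ Real.pi / d * √((m + 1 : ℕ) : ℝ) := by positivity
        linarith
      rw [hF, integral_indicator measurableSet_Ioc, ← intervalIntegral.integral_of_le hle]
      have h5 := intervalIntegral.integral_comp_div (a := -(Real.pi / d * √((m + 1 : ℕ) : ℝ)))
        (b := Real.pi / d * √((m + 1 : ℕ) : ℝ))
        (fun θ : ℝ => (Complex.exp ((-θ : ℝ) * Complex.I) * seqChar p θ) ^ (m + 1) *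
          Complex.exp ((θ : ℝ) * Complex.I)) hsm
      rw [neg_div, mul_div_cancel_right₀ _ hsm] at h5
      rw [h5]
      have h6 : ∀ θ : ℝ, (Complex.exp ((-θ : ℝ) * Complex.I) * seqChar p θ) ^ (m + 1) *
          Complex.exp ((θ : ℝ) * Complex.I) =
          seqChar p θ ^ (m + 1) * Complex.exp ((-(m * θ) : ℝ) * Complex.I) := by
        intro θ
        rw [mul_pow, ← Complex.exp_nat_mul, mul_comm (Complex.exp _), mul_assoc, ← Complex.exp_add]
        congr 2
        push_cast
        ring
      simp_rw [h6]
      rw [h, Complex.real_smul, ← Complex.ofReal_mul, Complex.ofReal_re]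
      ring
    have hev := (tendsto_add_atTop_iff_nat 1).2 hre |>.eventually (lt_mem_nhds (half_lt_self hL))
    obtain ⟨N, hN⟩ := eventually_atTop.1 hev
    have hfin : ∃ c' : ℝ, 0 < c' ∧ ∀ m ∈ Finset.range N, 0 < a m → c' ≤ a m := by
      generalize Finset.range N = S
      induction S using Finset.induction with
      | empty => exact ⟨1, one_pos, by simp⟩
      | insert x S _ ih =>
        obtain ⟨c', hc', h⟩ := ih
        by_cases hx : 0 < a x
        · refine ⟨min c' (a x), lt_min hc' hx, fun m hm hpos => ?_⟩
          rcases Finset.mem_insert.1 hm with rfl | hm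
          · exact min_le_right _ _
          · exact (min_le_left _ _).trans (h m hm hpos)
        · refine ⟨c', hc', fun m hm hpos => ?_⟩
          rcases Finset.mem_insert.1 hm with rfl | hm
          · exact absurd hpos hx
          · exact h m hm hpos
    obtain ⟨c', hc', hfin⟩ := hfin
    refine ⟨min c' (L / 2 / (2 * Real.pi / d)), lt_min hc' (by positivity), fun m hm => ?_⟩
    have hapos : 0 < a m := mul_pos hm (Real.sqrt_pos.2 (by positivity))
    rcases lt_or_ge m N with hmN | hmN
    · exact (min_le_left _ _).trans (hfin m (Finset.mem_range.2 hmN) hapos)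
    · refine (min_le_right _ _).trans ?_
      rw [div_le_iff₀ (by positivity)]
      have := hN m hmN
      rw [hFa m (dvd_of_coeff_mk_pow_ne_zero hdvd _ _ hm.ne')] at this
      exact this.le

end LocalLimit

section GeneratingFunctions

open scoped ENNReal

/-- generating function of a weight `v` on a type graded by `s` -/
noncomputable def gradedGF {α : Type*} (s : α → ℕ) (v : α → ℝ≥0∞) : PowerSeries ℝ≥0∞ :=
  PowerSeries.mk fun n => ∑' a, if s a = n then v a else 0

lemma coeff_gradedGF {α : Type*} (s : α → ℕ) (v : α → ℝ≥0∞) (n : ℕ) :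
    PowerSeries.coeff n (gradedGF s v) = ∑' a, if s a = n then v a else 0 :=
  PowerSeries.coeff_mk _ _

lemma gradedGF_add {α : Type*} (s : α → ℕ) (v w : α → ℝ≥0∞) :
    gradedGF s (fun a => v a + w a) = gradedGF s v + gradedGF s w := by
  ext n
  rw [map_add, coeff_gradedGF, coeff_gradedGF, coeff_gradedGF, ← ENNReal.tsum_add]
  refine tsum_congr fun a => ?_
  split_ifs <;> simp

lemma gradedGF_prod {α β : Type*} (s : α → ℕ) (s' : β → ℕ) (v : α → ℝ≥0∞) (v' : β → ℝ≥0∞) :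
    gradedGF (fun x : α × β => s x.1 + s' x.2) (fun x => v x.1 * v' x.2) =
      gradedGF s v * gradedGF s' v' := by
  ext n
  rw [PowerSeries.coeff_mul, coeff_gradedGF]
  simp_rw [coeff_gradedGF, ← ENNReal.tsum_mul_right, ← ENNReal.tsum_mul_left]
  rw [← Summable.tsum_finsetSum fun _ _ => ENNReal.summable, ENNReal.tsum_prod']
  refine tsum_congr fun a => ?_
  rw [← Summable.tsum_finsetSum fun _ _ => ENNReal.summable]
  refine tsum_congr fun b => ?_
  split_ifs with h
  · rw [Finset.sum_eq_single (s a, s' b)]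
    · simp
    · rintro ⟨x, y⟩ _ hne
      by_cases hx : s a = x
      · have hy : s' b ≠ y := fun hy => hne (by rw [hx, hy])
        simp [hy]
      · simp [hx]
    · intro hn
      exact absurd (Finset.HasAntidiagonal.mem_antidiagonal.2 h) hn
  · refine (Finset.sum_eq_zero ?_).symm
    rintro ⟨x, y⟩ hxy
    have hxy' : x + y = n := Finset.HasAntidiagonal.mem_antidiagonal.1 hxy
    by_cases hx : s a = x
    · have hy : s' b ≠ y := fun hy => h (by simp only; omega)
      simp [hy]
    · simp [hx]

/-- the `k`-th elementary symmetric function of the values of `g` along a list -/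
noncomputable def listEsymm {α : Type*} (g : α → ℝ≥0∞) : ℕ → List α → ℝ≥0∞
  | 0, _ => 1
  | _ + 1, [] => 0
  | k + 1, a :: l => g a * listEsymm g k l + listEsymm g (k + 1) l

lemma listEsymm_zero {α : Type*} (g : α → ℝ≥0∞) (l : List α) : listEsymm g 0 l = 1 := by
  cases l <;> rfl

lemma listEsymm_one {α : Type*} (g : α → ℝ≥0∞) (l : List α) :
    listEsymm g 1 l = (l.map g).sum := by
  induction l with
  | nil => rfl
  | cons a l ih => simp [listEsymm, ih]

lemma one_le_listEsymm {α : Type*} (q : α → Prop) [DecidablePred q] (k : ℕ) (l : List α)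
    (h : k ≤ l.countP (fun a => q a)) : 1 ≤ listEsymm (fun a => if q a then 1 else 0) k l := by
  induction l generalizing k with
  | nil =>
    obtain rfl : k = 0 := by simpa using h
    simp [listEsymm]
  | cons a l ih =>
    cases k with
    | zero => simp [listEsymm]
    | succ k =>
      rw [listEsymm]
      by_cases ha : q a
      · rw [List.countP_cons_of_pos (by simpa using ha)] at h
        rw [if_pos ha, one_mul]
        exact (ih k (by omega)).trans le_self_add
      · rw [List.countP_cons_of_neg (by simpa using ha)] at h
        exact (ih (k + 1) h).trans le_add_self

/-- generating function of the weight `v` on lists of length `j` -/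
noncomputable def listGF {α : Type*} (s : α → ℕ) (j : ℕ) (v : List α → ℝ≥0∞) :
    PowerSeries ℝ≥0∞ :=
  gradedGF (fun l : List α => (l.map s).sum) (fun l => if l.length = j then v l else 0)

lemma listGF_succ {α : Type*} (s : α → ℕ) (j : ℕ) (u : α → ℝ≥0∞) (v w : List α → ℝ≥0∞)
    (h : ∀ a l, w (a :: l) = u a * v l) :
    listGF s (j + 1) w = gradedGF s u * listGF s j v := by
  rw [listGF, listGF, ← gradedGF_prod]
  ext n
  rw [coeff_gradedGF, coeff_gradedGF]
  have hinj : Function.Injective fun x : α × List α => x.1 :: x.2 := by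
    rintro ⟨a, l⟩ ⟨b, l'⟩ h
    simpa using h
  rw [← hinj.tsum_eq]
  · refine tsum_congr fun x => ?_
    simp [h]
  · intro l hl
    cases l with
    | nil => simp at hl
    | cons a l => exact ⟨(a, l), rfl⟩

lemma listGF_add {α : Type*} (s : α → ℕ) (j : ℕ) (v w : List α → ℝ≥0∞) :
    listGF s j (fun l => v l + w l) = listGF s j v + listGF s j w := by
  rw [listGF, listGF, listGF, ← gradedGF_add]
  congr 1
  ext l
  split_ifs <;> simp

lemma listGF_zero {α : Type*} (s : α → ℕ) (v : List α → ℝ≥0∞) :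
    listGF s 0 v = PowerSeries.C (v []) := by
  ext n
  rw [listGF, coeff_gradedGF, tsum_eq_single [], PowerSeries.coeff_C]
  · simp [eq_comm]
  · intro l hl
    simp [hl]

lemma listGF_esymm {α : Type*} (s : α → ℕ) (v g : α → ℝ≥0∞) (j k : ℕ) :
    listGF s j (fun l => (l.map v).prod * listEsymm g k l) =
      (j.choose k : PowerSeries ℝ≥0∞) *
        (gradedGF s (fun a => v a * g a) ^ k * gradedGF s v ^ (j - k)) := by
  induction j generalizing k with
  | zero =>
    rw [listGF_zero]
    cases k <;> simp [listEsymm]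
  | succ j ih =>
    cases k with
    | zero =>
      rw [listGF_succ s j v (fun l => (l.map v).prod * listEsymm g 0 l), ih]
      · simp [pow_succ, mul_comm]
      · intro a l
        simp [listEsymm_zero]
    | succ k =>
      have hw : ∀ l, (fun l : List α => (l.map v).prod * listEsymm g (k + 1) l) l =
          (fun l => match l with
            | [] => 0
            | a :: l => v a * g a * ((l.map v).prod * listEsymm g k l)) l +
          (fun l => match l with
            | [] => 0
            | a :: l => v a * ((l.map v).prod * listEsymm g (k + 1) l)) l := by
        intro l
        cases l with
        | nil => simp [listEsymm]
        | cons a l => simp only [List.map_cons, List.prod_cons, listEsymm]; ring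
      rw [funext hw, listGF_add, listGF_succ s j (fun a => v a * g a)
          (fun l => (l.map v).prod * listEsymm g k l) _ (fun _ _ => rfl),
        listGF_succ s j v (fun l => (l.map v).prod * listEsymm g (k + 1) l) _ (fun _ _ => rfl),
        ih, ih, Nat.choose_succ_succ, Nat.add_sub_add_right]
      rcases lt_or_ge k j with h | h
      · obtain ⟨i, rfl⟩ : ∃ i, j = k + 1 + i := ⟨j - (k + 1), by omega⟩
        have e1 : k + 1 + i - k = i + 1 := by omega
        have e2 : k + 1 + i - (k + 1) = i := by omega
        rw [e1, e2]
        push_cast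
        ring
      · rw [Nat.choose_eq_zero_of_lt (show j < k + 1 by omega)]
        push_cast
        ring

lemma coeff_C_mul_nat (n m : ℕ) (f : PowerSeries ℝ≥0∞) :
    PowerSeries.coeff m ((n : PowerSeries ℝ≥0∞) * f) = n * PowerSeries.coeff m f := by
  rw [← map_natCast (PowerSeries.C (R := ℝ≥0∞)), PowerSeries.coeff_C_mul]

end GeneratingFunctions

section Trees

open scoped ENNReal

namespace PTree

lemma size_node (ts : List PTree) : (node ts).size = 1 + (ts.map size).sum := by
  rw [size, List.attach_map_val]

lemma subtrees_node (ts : List PTree) :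
    (node ts).subtrees = node ts :: (ts.map subtrees).flatten := by
  rw [subtrees, List.attach_map_val]

lemma weight_node (p : ℕ → ℝ) (ts : List PTree) :
    weight p (node ts) = p ts.length * (ts.map (weight p)).prod := by
  rw [weight, List.attach_map_val]

lemma induction_on {motive : PTree → Prop}
    (h : ∀ ts, (∀ t ∈ ts, motive t) → motive (node ts)) : ∀ T, motive T
  | node ts => h ts fun t _ht => induction_on h t
decreasing_by
  have := List.sizeOf_lt_of_mem _ht
  simp only [node.sizeOf_spec]; omega

lemma length_subtrees (T : PTree) : T.subtrees.length = T.size := by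
  induction T using induction_on with
  | h ts ih =>
    rw [subtrees_node, size_node, List.length_cons, List.length_flatten, List.map_map, add_comm]
    congr 2
    exact List.map_congr_left ih

lemma node_bijective : Function.Bijective node :=
  ⟨fun _ _ h => by simpa using h, fun ⟨ts⟩ => ⟨ts, rfl⟩⟩

/-- the sum of a function over the fringe subtrees -/
noncomputable def fringeSum (F : PTree → ℝ≥0∞) (T : PTree) : ℝ≥0∞ := (T.subtrees.map F).sum

lemma fringeSum_node (F : PTree → ℝ≥0∞) (ts : List PTree) :
    fringeSum F (node ts) = F (node ts) + (ts.map (fringeSum F)).sum := by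
  rw [fringeSum, subtrees_node, List.map_cons, List.sum_cons, List.map_flatten, List.sum_flatten,
    List.map_map, List.map_map]
  rfl

variable {P : ℕ → ℝ≥0∞} {W : PTree → ℝ≥0∞}

lemma coeff_zero_gradedGF_size (v : PTree → ℝ≥0∞) :
    PowerSeries.coeff 0 (gradedGF size v) = 0 := by
  rw [coeff_gradedGF]
  refine ENNReal.tsum_eq_zero.2 fun ⟨ts⟩ => if_neg ?_
  rw [size_node]
  omega

lemma coeff_succ_gradedGF_size (hW : ∀ ts, W (node ts) = P ts.length * (ts.map W).prod)
    (F : PTree → ℝ≥0∞) (m : ℕ) :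
    PowerSeries.coeff (m + 1) (gradedGF size fun T => W T * F T) =
      ∑' j, P j * PowerSeries.coeff m
        (listGF size j fun l => (l.map W).prod * F (node l)) := by
  simp_rw [listGF, coeff_gradedGF, ← ENNReal.tsum_mul_left]
  rw [ENNReal.tsum_comm, ← (Equiv.ofBijective node node_bijective).tsum_eq]
  refine tsum_congr fun l => ?_
  rw [tsum_eq_single l.length]
  · simp only [Equiv.ofBijective_apply, size_node, hW, if_true]
    rw [add_comm, mul_ite, mul_zero]
    simp only [add_left_inj, mul_assoc]
  · intro j hj
    simp [hj.symm]

lemma coeff_succ_sizeGF (hW : ∀ ts, W (node ts) = P ts.length * (ts.map W).prod) (m : ℕ) :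
    PowerSeries.coeff (m + 1) (gradedGF size W) =
      ∑' j, P j * PowerSeries.coeff m (gradedGF size W ^ j) := by
  have h := coeff_succ_gradedGF_size hW (fun _ => 1) m
  simp only [mul_one] at h
  rw [h]
  refine tsum_congr fun j => ?_
  have h2 := listGF_esymm size W (fun _ => 1) j 0
  simp only [listEsymm_zero, mul_one, Nat.choose_zero_right, Nat.cast_one, pow_zero, one_mul,
    Nat.sub_zero] at h2
  rw [h2]

/-- the generating function of the spine decomposition: one child is marked -/
noncomputable def spineGF (P : ℕ → ℝ≥0∞) (W : PTree → ℝ≥0∞) : PowerSeries ℝ≥0∞ :=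
  PowerSeries.mk fun s => ∑' j, P j * (j * PowerSeries.coeff s (gradedGF size W ^ (j - 1)))

lemma gradedGF_fringeSum (hW : ∀ ts, W (node ts) = P ts.length * (ts.map W).prod)
    (F : PTree → ℝ≥0∞) :
    gradedGF size (fun T => W T * fringeSum F T) = gradedGF size (fun T => W T * F T) +
      PowerSeries.X * (spineGF P W * gradedGF size (fun T => W T * fringeSum F T)) := by
  ext n
  cases n with
  | zero => rw [map_add, PowerSeries.coeff_zero_X_mul]; simp only [coeff_zero_gradedGF_size, add_zero]
  | succ m =>
    rw [map_add, PowerSeries.coeff_succ_X_mul, coeff_succ_gradedGF_size hW,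
      coeff_succ_gradedGF_size hW]
    simp_rw [fringeSum_node, mul_add, listGF_add, map_add, mul_add]
    rw [ENNReal.tsum_add]
    congr 1
    simp_rw [PowerSeries.coeff_mul, spineGF, PowerSeries.coeff_mk, ← ENNReal.tsum_mul_right]
    rw [← Summable.tsum_finsetSum fun _ _ => ENNReal.summable]
    refine tsum_congr fun j => ?_
    simp_rw [← listEsymm_one]
    rw [listGF_esymm, coeff_C_mul_nat, Nat.choose_one_right, pow_one, mul_comm (gradedGF size _),
      PowerSeries.coeff_mul, Finset.mul_sum, Finset.mul_sum]
    refine Finset.sum_congr rfl fun x _ => ?_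
    ring

lemma eq_of_eq_add_X_mul {D K Z Z' : PowerSeries ℝ≥0∞} (h : Z = D + PowerSeries.X * (K * Z))
    (h' : Z' = D + PowerSeries.X * (K * Z')) : Z = Z' := by
  ext n
  induction n using Nat.strong_induction_on with
  | _ n ih =>
    rw [h, h']
    cases n with
    | zero => simp
    | succ n =>
      rw [map_add, map_add, PowerSeries.coeff_succ_X_mul, PowerSeries.coeff_succ_X_mul,
        PowerSeries.coeff_mul, PowerSeries.coeff_mul]
      congr 1
      refine Finset.sum_congr rfl fun x hx => ?_
      have := Finset.HasAntidiagonal.mem_antidiagonal.1 hx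
      rw [ih x.2 (by omega)]

/-- the indicator of the one-node tree -/
noncomputable def leafInd (T : PTree) : ℝ≥0∞ := if T.size = 1 then 1 else 0

lemma gradedGF_leafInd (hW : ∀ ts, W (node ts) = P ts.length * (ts.map W).prod) :
    gradedGF size (fun T => W T * leafInd T) = PowerSeries.C (P 0) * PowerSeries.X := by
  ext n
  rw [PowerSeries.coeff_C_mul, PowerSeries.coeff_X]
  by_cases hn : n = 1
  · subst hn
    have h := coeff_succ_sizeGF hW 0
    rw [tsum_eq_single 0, pow_zero, PowerSeries.coeff_zero_one] at h
    · rw [if_pos rfl, ← h, coeff_gradedGF, coeff_gradedGF]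
      refine tsum_congr fun T => ?_
      by_cases hT : T.size = 1 <;> simp [leafInd, hT]
    · intro j hj
      have h0 := coeff_zero_gradedGF_size W
      rw [PowerSeries.coeff_zero_eq_constantCoeff] at h0 ⊢
      rw [map_pow, h0, zero_pow hj, mul_zero]
  · rw [if_neg hn, mul_zero, coeff_gradedGF]
    refine ENNReal.tsum_eq_zero.2 fun T => ?_
    by_cases hT : T.size = n
    · have : T.size ≠ 1 := by omega
      simp [leafInd, this]
    · simp [hT]

lemma coeff_leafCount_le (n : ℕ) :
    PowerSeries.coeff n (gradedGF size fun T => W T * fringeSum leafInd T) ≤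
      n * PowerSeries.coeff n (gradedGF size W) := by
  rw [coeff_gradedGF, coeff_gradedGF, ← ENNReal.tsum_mul_left]
  refine ENNReal.tsum_le_tsum fun T => ?_
  split_ifs with h
  · rw [mul_comm, ← h, ← length_subtrees]
    gcongr
    rw [fringeSum]
    generalize T.subtrees = l
    induction l with
    | nil => simp
    | cons a l ih =>
      rw [List.map_cons, List.sum_cons, List.length_cons, Nat.cast_succ, add_comm]
      gcongr
      rw [leafInd]
      split_ifs <;> simp
  · simp

/-- The expected number of fringe subtrees with a given property, through the number of leaves. -/
lemma mul_coeff_fringeSum_le (hW : ∀ ts, W (node ts) = P ts.length * (ts.map W).prod)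
    (F : PTree → ℝ≥0∞) (n : ℕ) :
    P 0 * PowerSeries.coeff n (gradedGF size fun T => W T * fringeSum F T) ≤
      ∑ x ∈ Finset.HasAntidiagonal.antidiagonal (n + 1),
        PowerSeries.coeff x.1 (gradedGF size fun T => W T * F T) *
          (x.2 * PowerSeries.coeff x.2 (gradedGF size W)) := by
  set A := gradedGF size fun T => W T * F T
  set M := gradedGF size fun T => W T * fringeSum F T with hM
  set L := gradedGF size fun T => W T * fringeSum leafInd T with hL
  have h1 : M = A + PowerSeries.X * (spineGF P W * M) := gradedGF_fringeSum hW F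
  have h2 : L = PowerSeries.C (P 0) * PowerSeries.X + PowerSeries.X * (spineGF P W * L) := by
    rw [← gradedGF_leafInd hW]
    exact gradedGF_fringeSum hW leafInd
  have h3 : PowerSeries.X * (PowerSeries.C (P 0) * M) = A * L := by
    refine eq_of_eq_add_X_mul (D := PowerSeries.X * (PowerSeries.C (P 0) * A))
      (K := spineGF P W) ?_ ?_
    · conv_lhs => rw [h1]
      ring
    · conv_lhs => rw [h2]
      ring
  have h4 := congrArg (PowerSeries.coeff (n + 1)) h3
  rw [PowerSeries.coeff_succ_X_mul, PowerSeries.coeff_C_mul, PowerSeries.coeff_mul] at h4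
  rw [h4]
  gcongr
  exact coeff_leafCount_le _

/-- total mass of a power series -/
noncomputable def _root_.PowerSeries.mass (f : PowerSeries ℝ≥0∞) : ℝ≥0∞ :=
  ∑' n, PowerSeries.coeff n f

lemma _root_.PowerSeries.sum_range_coeff_mul_le (f g : PowerSeries ℝ≥0∞) (N : ℕ) :
    ∑ i ∈ Finset.range N, PowerSeries.coeff i (f * g) ≤
      (∑ i ∈ Finset.range N, PowerSeries.coeff i f) *
        ∑ i ∈ Finset.range N, PowerSeries.coeff i g := by
  simp_rw [PowerSeries.coeff_mul, Finset.sum_mul_sum, ← Finset.sum_product']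
  rw [Finset.sum_sigma']
  rw [← Finset.sum_image (f := fun x : ℕ × ℕ => PowerSeries.coeff x.1 f * PowerSeries.coeff x.2 g)
    (g := fun x : (_ : ℕ) × ℕ × ℕ => x.2)]
  · refine Finset.sum_le_sum_of_subset fun x hx => ?_
    obtain ⟨⟨i, y⟩, hy, rfl⟩ := Finset.mem_image.1 hx
    rw [Finset.mem_sigma, Finset.mem_range] at hy
    have := Finset.HasAntidiagonal.mem_antidiagonal.1 hy.2
    simp only at this hy
    rw [Finset.mem_product, Finset.mem_range, Finset.mem_range]
    exact ⟨by simp only; omega, by simp only; omega⟩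
  · rintro ⟨i, y⟩ hi ⟨j, z⟩ hj (rfl : y = z)
    have h1 := Finset.HasAntidiagonal.mem_antidiagonal.1 (Finset.mem_sigma.1 hi).2
    have h2 := Finset.HasAntidiagonal.mem_antidiagonal.1 (Finset.mem_sigma.1 hj).2
    simp only at h1 h2
    subst h1
    subst h2
    rfl

lemma _root_.PowerSeries.mass_mul (f g : PowerSeries ℝ≥0∞) : (f * g).mass = f.mass * g.mass := by
  simp_rw [PowerSeries.mass, PowerSeries.coeff_mul, ← ENNReal.tsum_mul_right,
    ← ENNReal.tsum_mul_left]
  rw [← ENNReal.tsum_prod (f := fun a b => PowerSeries.coeff a f * PowerSeries.coeff b g),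
    ← (Finset.HasAntidiagonal.sigmaAntidiagonalEquivProd (A := ℕ)).tsum_eq, ENNReal.tsum_sigma']
  refine tsum_congr fun n => ?_
  rw [← Finset.tsum_subtype]
  rfl

lemma mass_sizeGF_le_one (hW : ∀ ts, W (node ts) = P ts.length * (ts.map W).prod)
    (hP : ∑' j, P j ≤ 1) : (gradedGF size W).mass ≤ 1 := by
  have hpow : ∀ (f : PowerSeries ℝ≥0∞) (N j : ℕ),
      ∑ i ∈ Finset.range N, PowerSeries.coeff i f ≤ 1 →
      ∑ i ∈ Finset.range N, PowerSeries.coeff i (f ^ j) ≤ 1 := by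
    intro f N j h
    induction j with
    | zero =>
      rw [pow_zero]
      simp_rw [PowerSeries.coeff_one]
      rw [Finset.sum_ite_eq']
      split_ifs <;> simp
    | succ j ih =>
      rw [pow_succ]
      exact (PowerSeries.sum_range_coeff_mul_le _ _ _).trans (mul_le_one' ih h)
  have hN : ∀ N, ∑ i ∈ Finset.range N, PowerSeries.coeff i (gradedGF size W) ≤ 1 := by
    intro N
    induction N with
    | zero => simp
    | succ N ih =>
      rw [Finset.sum_range_succ', coeff_zero_gradedGF_size, add_zero]
      simp_rw [coeff_succ_sizeGF hW]
      rw [← Summable.tsum_finsetSum fun _ _ => ENNReal.summable]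
      refine (ENNReal.tsum_le_tsum fun j => ?_).trans hP
      rw [← Finset.mul_sum]
      exact mul_le_of_le_one_right' (hpow _ N j ih)
  exact ENNReal.tsum_le_of_sum_range_le hN

lemma coeff_sizeGF_pow_of_lt {m d : ℕ} (h : m < d) :
    PowerSeries.coeff m (gradedGF size W ^ d) = 0 := by
  have h1 : PowerSeries.X ∣ gradedGF size W := by
    rw [PowerSeries.X_dvd_iff, ← PowerSeries.coeff_zero_eq_constantCoeff_apply]
    exact coeff_zero_gradedGF_size W
  exact PowerSeries.X_pow_dvd_iff.1 (pow_dvd_pow_of_dvd h1 d) m h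

lemma coeff_succ_sizeGF_pow_succ (hW : ∀ ts, W (node ts) = P ts.length * (ts.map W).prod)
    (m d : ℕ) : PowerSeries.coeff (m + 1) (gradedGF size W ^ (d + 1)) =
      ∑' j, P j * PowerSeries.coeff m (gradedGF size W ^ (j + d)) := by
  rw [pow_succ', PowerSeries.coeff_mul, Finset.Nat.sum_antidiagonal_succ,
    coeff_zero_gradedGF_size, zero_mul, zero_add]
  simp_rw [coeff_succ_sizeGF hW, ← ENNReal.tsum_mul_right]
  rw [← Summable.tsum_finsetSum fun _ _ => ENNReal.summable]
  refine tsum_congr fun j => ?_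
  rw [pow_add, PowerSeries.coeff_mul, Finset.mul_sum]
  exact Finset.sum_congr rfl fun x _ => mul_assoc _ _ _

lemma coeff_X_mul_derivative (f : PowerSeries ℝ≥0∞) (r : ℕ) :
    PowerSeries.coeff r (PowerSeries.X * PowerSeries.derivative ℝ≥0∞ f) =
      r * PowerSeries.coeff r f := by
  cases r with
  | zero => simp
  | succ r =>
    rw [PowerSeries.coeff_succ_X_mul, PowerSeries.coeff_derivative, mul_comm]
    push_cast
    rfl

/-- The cycle lemma for forests of `d` trees with `m` nodes in total. -/
lemma cycle_lemma (hW : ∀ ts, W (node ts) = P ts.length * (ts.map W).prod) (d r : ℕ) :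
    ((r + d : ℕ) : ℝ≥0∞) * PowerSeries.coeff (r + d) (gradedGF size W ^ d) =
      d * PowerSeries.coeff r (PowerSeries.mk P ^ (r + d)) := by
  generalize hm : r + d = m
  induction m generalizing r d with
  | zero =>
    obtain ⟨rfl, rfl⟩ : r = 0 ∧ d = 0 := by omega
    simp
  | succ m ih =>
    cases d with
    | zero => simp [PowerSeries.coeff_one]
    | succ d =>
      have hstep : PowerSeries.coeff (m + 1) (gradedGF size W ^ (d + 1)) =
          ∑ x ∈ Finset.HasAntidiagonal.antidiagonal r,
            P x.1 * PowerSeries.coeff m (gradedGF size W ^ (x.1 + d)) := by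
        rw [coeff_succ_sizeGF_pow_succ hW, tsum_eq_sum (s := Finset.range (r + 1)),
          Finset.Nat.sum_antidiagonal_eq_sum_range_succ_mk]
        intro j hj
        rw [Finset.mem_range] at hj
        rw [coeff_sizeGF_pow_of_lt (by omega), mul_zero]
      rw [hstep]
      rcases Nat.eq_zero_or_pos m with rfl | hm0
      · obtain ⟨rfl, rfl⟩ : r = 0 ∧ d = 0 := by omega
        simp
      · set c := PowerSeries.coeff r (PowerSeries.mk P ^ (m + 1)) with hc
        have h1 : (m : ℝ≥0∞) * ∑ x ∈ Finset.HasAntidiagonal.antidiagonal r,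
            P x.1 * PowerSeries.coeff m (gradedGF size W ^ (x.1 + d)) =
            d * c + PowerSeries.coeff r (PowerSeries.X *
              (PowerSeries.derivative ℝ≥0∞ (PowerSeries.mk P)) * PowerSeries.mk P ^ m) := by
          rw [hc, pow_succ', PowerSeries.coeff_mul, PowerSeries.coeff_mul, Finset.mul_sum,
            Finset.mul_sum, ← Finset.sum_add_distrib]
          refine Finset.sum_congr rfl fun x hx => ?_
          have hx' := Finset.HasAntidiagonal.mem_antidiagonal.1 hx
          rw [mul_left_comm, ih (x.1 + d) x.2 (by omega), coeff_X_mul_derivative,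
            PowerSeries.coeff_mk]
          push_cast
          ring
        have h2 : ((m + 1 : ℕ) : ℝ≥0∞) * PowerSeries.coeff r (PowerSeries.X *
              (PowerSeries.derivative ℝ≥0∞ (PowerSeries.mk P)) * PowerSeries.mk P ^ m) =
            r * c := by
          rw [hc, ← coeff_X_mul_derivative, Derivation.leibniz_pow, ← coeff_C_mul_nat]
          congr 1
          simp only [Nat.add_sub_cancel, smul_eq_mul, nsmul_eq_mul]
          ring
        refine (ENNReal.mul_right_inj (a := (m : ℝ≥0∞)) (by simpa using hm0.ne') (by simp)).1 ?_
        rw [mul_left_comm, h1, mul_add, h2, ← mul_assoc, ← mul_assoc, ← add_mul]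
        congr 1
        norm_cast
        have : m = r + d := by omega
        subst this
        ring

end PTree

end Trees

section Decay

open scoped ENNReal

lemma natCast_rpow_eq_ofReal {n : ℕ} (hn : n ≠ 0) (s : ℝ) :
    (n : ℝ≥0∞) ^ s = ENNReal.ofReal ((n : ℝ) ^ s) := by
  rw [← ENNReal.ofReal_rpow_of_pos (by positivity), ENNReal.ofReal_natCast]

lemma natCast_rpow_neg_le {a m : ℕ} {s : ℝ} (hs : 0 ≤ s) (hm : m ≠ 0) (h : m ≤ 2 * a) :
    (a : ℝ≥0∞) ^ (-s) ≤ 2 ^ s * (m : ℝ≥0∞) ^ (-s) := by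
  have ha : a ≠ 0 := by omega
  rw [natCast_rpow_eq_ofReal ha, natCast_rpow_eq_ofReal hm,
    show (2 : ℝ≥0∞) = ((2 : ℕ) : ℝ≥0∞) by norm_num, natCast_rpow_eq_ofReal two_ne_zero,
    ← ENNReal.ofReal_mul (by positivity)]
  refine ENNReal.ofReal_le_ofReal ?_
  have h2 : ((m : ℝ)) ^ s ≤ (((2 : ℕ) : ℝ)) ^ s * (a : ℝ) ^ s := by
    rw [← Real.mul_rpow (by positivity) (by positivity)]
    exact Real.rpow_le_rpow (by positivity) (by exact_mod_cast h) hs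
  rw [Real.rpow_neg (by positivity), Real.rpow_neg (by positivity), ← div_eq_mul_inv,
    inv_le_comm₀ (by positivity) (by positivity), inv_div, div_le_iff₀ (by positivity)]
  linarith

lemma inv_sqrt_cube_add_le {n : ℝ} (hn : 1 ≤ n) :
    n ^ (-(3 / 2) : ℝ) + 4 * (√(n + 1))⁻¹ ≤ 4 * (√n)⁻¹ := by
  have hs : 0 < √n := by positivity
  have hu : 0 < √(n + 1) := by positivity
  have hs2 : √n ^ 2 = n := Real.sq_sqrt (by positivity)
  have hu2 : √(n + 1) ^ 2 = n + 1 := Real.sq_sqrt (by positivity)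
  have e : n ^ (-(3 / 2) : ℝ) = (√n ^ 3)⁻¹ := by
    rw [Real.rpow_neg (by positivity), Real.sqrt_eq_rpow, ← Real.rpow_natCast,
      ← Real.rpow_mul (by positivity)]
    norm_num
  rw [e]
  set s := √n
  set u := √(n + 1)
  have hsu : s ≤ u := Real.sqrt_le_sqrt (by linarith)
  have key : u ≤ 4 * s ^ 2 * (u - s) := by
    have h1 : (u - s) * (u + s) = 1 := by ring_nf; linarith
    have h2 : 1 ≤ (u - s) * (2 * u) := by nlinarith
    have h3 : u ^ 2 ≤ 2 * s ^ 2 := by linarith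
    nlinarith [mul_le_mul_of_nonneg_left h2 hu.le, mul_nonneg (sub_nonneg.2 hsu) hu.le]
  have : 4 * s⁻¹ - 4 * u⁻¹ - (s ^ 3)⁻¹ = (4 * s ^ 2 * (u - s) - u) / (s ^ 3 * u) := by
    field_simp
  have h0 : 0 ≤ (4 * s ^ 2 * (u - s) - u) / (s ^ 3 * u) :=
    div_nonneg (by linarith) (by positivity)
  linarith

lemma tsum_natCast_rpow_tail_le {x : ℝ} (hx : 0 < x) :
    ∑' n : ℕ, (if x ≤ n then (n : ℝ≥0∞) ^ (-(3 / 2) : ℝ) else 0) ≤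
      4 * ENNReal.ofReal x ^ (-(1 / 2) : ℝ) := by
  set N := ⌈x⌉₊ with hN
  have hN1 : 1 ≤ N := Nat.one_le_iff_ne_zero.2 (Nat.ceil_pos.2 hx).ne'
  have h1 : ∑' n : ℕ, (if x ≤ n then (n : ℝ≥0∞) ^ (-(3 / 2) : ℝ) else 0) =
      ∑' i : ℕ, ((i + N : ℕ) : ℝ≥0∞) ^ (-(3 / 2) : ℝ) := by
    rw [← (add_left_injective N).tsum_eq]
    · refine tsum_congr fun i => if_pos ?_
      rw [← Nat.ceil_le]
      exact Nat.le_add_left _ _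
    · intro n hn
      have : N ≤ n := by
        by_contra hlt
        rw [hN, Nat.ceil_le] at hlt
        exact hn (if_neg hlt)
      exact ⟨n - N, Nat.sub_add_cancel this⟩
  have h2 : ∀ m : ℕ, ∑ i ∈ Finset.range m, ((i + N : ℕ) : ℝ≥0∞) ^ (-(3 / 2) : ℝ) +
      ENNReal.ofReal (4 * (√((m + N : ℕ) : ℝ))⁻¹) ≤ ENNReal.ofReal (4 * (√(N : ℝ))⁻¹) := by
    intro m
    induction m with
    | zero => simp
    | succ m ih =>
      refine le_trans ?_ ih
      rw [Finset.sum_range_succ, add_assoc]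
      gcongr
      rw [natCast_rpow_eq_ofReal (by omega), ← ENNReal.ofReal_add (by positivity) (by positivity)]
      refine ENNReal.ofReal_le_ofReal ?_
      have hc : ((m + 1 + N : ℕ) : ℝ) = ((m + N : ℕ) : ℝ) + 1 := by push_cast; ring
      rw [hc]
      exact inv_sqrt_cube_add_le (by exact_mod_cast (by omega : 1 ≤ m + N))
  rw [h1]
  refine (ENNReal.tsum_le_of_sum_range_le fun m => le_self_add.trans (h2 m)).trans ?_
  rw [ENNReal.ofReal_rpow_of_pos hx, ENNReal.ofReal_mul (by norm_num)]
  have h4 : ENNReal.ofReal 4 = 4 := by norm_num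
  rw [h4, Real.rpow_neg hx.le, ← Real.sqrt_eq_rpow]
  gcongr
  exact Nat.le_ceil x

lemma sum_natCast_rpow_neg_half_le (N : ℕ) :
    ∑ b ∈ Finset.range N, ((b + 1 : ℕ) : ℝ≥0∞) ^ (-(1 / 2) : ℝ) ≤
      2 * (N : ℝ≥0∞) ^ (1 / 2 : ℝ) := by
  have h : ∀ N : ℕ, ∑ b ∈ Finset.range N, ((b + 1 : ℕ) : ℝ≥0∞) ^ (-(1 / 2) : ℝ) ≤
      ENNReal.ofReal (2 * √(N : ℝ)) := by
    intro N
    induction N with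
    | zero => simp
    | succ N ih =>
      rw [Finset.sum_range_succ]
      refine (add_le_add_left ih _).trans ?_
      rw [natCast_rpow_eq_ofReal (by omega), ← ENNReal.ofReal_add (by positivity) (by positivity)]
      refine ENNReal.ofReal_le_ofReal ?_
      rw [Real.rpow_neg (by positivity), ← Real.sqrt_eq_rpow]
      have hu : 0 < √((N + 1 : ℕ) : ℝ) := by positivity
      have hs2 : √(N : ℝ) ^ 2 = N := Real.sq_sqrt (by positivity)
      have hu2 : √((N + 1 : ℕ) : ℝ) ^ 2 = N + 1 := by
        rw [Real.sq_sqrt (by positivity)]; push_cast; ring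
      have hs : 0 ≤ √(N : ℝ) := by positivity
      set u := √((N + 1 : ℕ) : ℝ)
      set s := √(N : ℝ)
      have : 2 * u - 2 * s - u⁻¹ = (u - s) ^ 2 / u := by
        field_simp
        linarith
      have : 0 ≤ (u - s) ^ 2 / u := by positivity
      linarith
  refine (h N).trans ?_
  rw [ENNReal.ofReal_mul (by norm_num), ENNReal.ofReal_ofNat, Real.sqrt_eq_rpow,
    ← ENNReal.ofReal_rpow_of_nonneg (by positivity) (by positivity), ENNReal.ofReal_natCast]

namespace PowerSeries

/-- the coefficients of positive index are dominated by `α n ^ (-3/2)` -/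
def DecayLe (f : PowerSeries ℝ≥0∞) (α : ℝ≥0∞) : Prop :=
  ∀ n : ℕ, n ≠ 0 → coeff n f ≤ α * (n : ℝ≥0∞) ^ (-(3 / 2) : ℝ)

lemma sum_antidiagonal_fst_le_mass (f : PowerSeries ℝ≥0∞) (n : ℕ) :
    ∑ x ∈ Finset.HasAntidiagonal.antidiagonal n, coeff x.1 f ≤ f.mass := by
  rw [Finset.Nat.sum_antidiagonal_eq_sum_range_succ_mk]
  exact ENNReal.sum_le_tsum _

lemma sum_antidiagonal_snd_le_mass (f : PowerSeries ℝ≥0∞) (n : ℕ) :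
    ∑ x ∈ Finset.HasAntidiagonal.antidiagonal n, coeff x.2 f ≤ f.mass := by
  rw [← Finset.Nat.sum_antidiagonal_swap]
  exact sum_antidiagonal_fst_le_mass f n

lemma DecayLe.mul {f g : PowerSeries ℝ≥0∞} {α β : ℝ≥0∞} (hf : DecayLe f α)
    (hg : DecayLe g β) :
    DecayLe (f * g) (2 ^ (3 / 2 : ℝ) * (α * g.mass + β * f.mass)) := by
  intro m hm
  set K : ℝ≥0∞ := 2 ^ (3 / 2 : ℝ) * (m : ℝ≥0∞) ^ (-(3 / 2) : ℝ) with hK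
  rw [coeff_mul]
  have hterm : ∀ x ∈ Finset.HasAntidiagonal.antidiagonal m,
      coeff x.1 f * coeff x.2 g ≤ α * K * coeff x.2 g + β * K * coeff x.1 f := by
    intro x hx
    have hx' := Finset.HasAntidiagonal.mem_antidiagonal.1 hx
    rcases le_total m (2 * x.1) with h | h
    · refine le_trans ?_ le_self_add
      gcongr
      exact (hf x.1 (by omega)).trans (by
        gcongr
        exact natCast_rpow_neg_le (by norm_num) hm h)
    · refine le_trans ?_ le_add_self
      rw [mul_comm]
      gcongr
      exact (hg x.2 (by omega)).trans (by
        gcongr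
        exact natCast_rpow_neg_le (by norm_num) hm (by omega))
  refine (Finset.sum_le_sum hterm).trans ?_
  rw [Finset.sum_add_distrib, ← Finset.mul_sum, ← Finset.mul_sum]
  calc _ ≤ α * K * g.mass + β * K * f.mass := by
        gcongr
        · exact sum_antidiagonal_snd_le_mass g m
        · exact sum_antidiagonal_fst_le_mass f m
    _ = _ := by rw [hK]; ring

lemma mass_one : (1 : PowerSeries ℝ≥0∞).mass = 1 := by
  rw [mass]
  simp_rw [coeff_one]
  rw [tsum_ite_eq]

lemma mass_pow (f : PowerSeries ℝ≥0∞) (k : ℕ) : (f ^ k).mass = f.mass ^ k := by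
  induction k with
  | zero => rw [pow_zero, pow_zero, mass_one]
  | succ k ih => rw [pow_succ, pow_succ, mass_mul, ih]

lemma exists_decayLe_pow (k : ℕ) : ∃ A : ℝ≥0∞, A ≠ ⊤ ∧ ∀ (f : PowerSeries ℝ≥0∞) (α : ℝ≥0∞),
    DecayLe f α → DecayLe (f ^ (k + 1)) (A * α * f.mass ^ k) := by
  induction k with
  | zero => exact ⟨1, by simp, fun f α h => by simpa using h⟩
  | succ k ih =>
    obtain ⟨A, hA, h⟩ := ih
    refine ⟨2 ^ (3 / 2 : ℝ) * (A + 1), ?_, fun f α hf => ?_⟩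
    · refine ENNReal.mul_ne_top (ENNReal.rpow_ne_top_of_nonneg (by norm_num) (by simp)) ?_
      exact ENNReal.add_ne_top.2 ⟨hA, by simp⟩
    · have := (h f α hf).mul hf
      rw [← pow_succ, mass_pow] at this
      convert this using 1
      ring

/-- convolution of a summable sequence with `b ↦ b ^ (-1/2)` -/
lemma sum_antidiagonal_mul_le {f g : ℕ → ℝ≥0∞} {R α : ℝ≥0∞} {N : ℕ} (hN : N ≠ 0)
    (hf : ∀ a, f a * a ≤ R) (hfs : ∑' a, f a ≤ R) (hg0 : g 0 = 0)
    (hg : ∀ b, b ≠ 0 → g b ≤ α * (b : ℝ≥0∞) ^ (-(1 / 2) : ℝ)) :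
    ∑ x ∈ Finset.HasAntidiagonal.antidiagonal N, f x.1 * g x.2 ≤
      (2 ^ (1 / 2 : ℝ) + 4) * (R * α * (N : ℝ≥0∞) ^ (-(1 / 2) : ℝ)) := by
  have hNt : (N : ℝ≥0∞) ≠ ⊤ := by simp
  have hN0 : (N : ℝ≥0∞) ≠ 0 := by simpa using hN
  set K : ℝ≥0∞ := α * (2 ^ (1 / 2 : ℝ) * (N : ℝ≥0∞) ^ (-(1 / 2) : ℝ)) with hK
  have hterm : ∀ x ∈ Finset.HasAntidiagonal.antidiagonal N,
      f x.1 * g x.2 ≤ K * f x.1 + 2 * R * (N : ℝ≥0∞)⁻¹ * g x.2 := by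
    intro x hx
    have hx' := Finset.HasAntidiagonal.mem_antidiagonal.1 hx
    rcases le_total N (2 * x.2) with h | h
    · refine le_trans ?_ le_self_add
      rw [mul_comm]
      gcongr
      exact (hg x.2 (by omega)).trans
        (mul_le_mul_right (natCast_rpow_neg_le (by norm_num) hN h) α)
    · refine le_trans ?_ le_add_self
      gcongr
      rw [← div_eq_mul_inv, ENNReal.le_div_iff_mul_le (Or.inl hN0) (Or.inl hNt)]
      calc f x.1 * N ≤ f x.1 * ((2 * x.1 : ℕ) : ℝ≥0∞) := by
            gcongr
            omega
        _ = 2 * (f x.1 * x.1) := by push_cast; ring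
        _ ≤ 2 * R := by gcongr; exact hf _
  have hfsum : ∑ x ∈ Finset.HasAntidiagonal.antidiagonal N, f x.1 ≤ R := by
    rw [Finset.Nat.sum_antidiagonal_eq_sum_range_succ_mk]
    exact (ENNReal.sum_le_tsum _).trans hfs
  have hgsum : ∑ x ∈ Finset.HasAntidiagonal.antidiagonal N, g x.2 ≤
      α * (2 * (N : ℝ≥0∞) ^ (1 / 2 : ℝ)) := by
    rw [← Finset.Nat.sum_antidiagonal_swap]
    simp only [Prod.snd_swap]
    rw [Finset.Nat.sum_antidiagonal_eq_sum_range_succ_mk, Finset.sum_range_succ', hg0, add_zero]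
    refine le_trans ?_ (mul_le_mul_right (sum_natCast_rpow_neg_half_le N) α)
    rw [Finset.mul_sum]
    exact Finset.sum_le_sum fun b _ => hg _ (by omega)
  refine (Finset.sum_le_sum hterm).trans ?_
  rw [Finset.sum_add_distrib, ← Finset.mul_sum, ← Finset.mul_sum]
  have e : (N : ℝ≥0∞)⁻¹ * (N : ℝ≥0∞) ^ (1 / 2 : ℝ) = (N : ℝ≥0∞) ^ (-(1 / 2) : ℝ) := by
    rw [← ENNReal.rpow_neg_one, ← ENNReal.rpow_add _ _ hN0 hNt]
    norm_num
  calc _ ≤ K * R + 2 * R * (N : ℝ≥0∞)⁻¹ * (α * (2 * (N : ℝ≥0∞) ^ (1 / 2 : ℝ))) := by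
        gcongr
    _ = K * R + 4 * (R * α * ((N : ℝ≥0∞)⁻¹ * (N : ℝ≥0∞) ^ (1 / 2 : ℝ))) := by ring
    _ = _ := by rw [e, hK]; ring

end PowerSeries

end Decay

section FringeTail

open scoped ENNReal

namespace PTree

open PowerSeries (DecayLe)

lemma le_countP_Nk {k : ℕ} {ts : List PTree} (h : 0 < Nk k (node ts)) :
    k ≤ ts.countP fun s => Nk k (node ts) ≤ s.size := by
  set L := sortedSizesDesc (node ts) with hL
  have hNk : Nk k (node ts) = L.getD (k - 1) 0 := rfl
  rw [hNk] at h ⊢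
  have hperm : L.Perm (ts.map size) := List.perm_insertionSort _ _
  have hsort : L.Pairwise (· ≥ ·) := List.pairwise_insertionSort _ _
  have hlt : k - 1 < L.length := by
    by_contra hge
    rw [List.getD_eq_default _ _ (by omega)] at h
    exact lt_irrefl _ h
  have h1 : ts.countP (fun s => L.getD (k - 1) 0 ≤ s.size) =
      L.countP fun x => L.getD (k - 1) 0 ≤ x := by
    rw [hperm.countP_eq, List.countP_map]
    rfl
  have h2 : (L.take k).countP (fun x => L.getD (k - 1) 0 ≤ x) = (L.take k).length := by
    rw [List.countP_eq_length]
    intro x hx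
    obtain ⟨i, hi, rfl⟩ := List.mem_take_iff_getElem.1 hx
    rw [List.getD_eq_getElem _ _ hlt, decide_eq_true_eq]
    rcases Nat.lt_or_ge i (k - 1) with hik | hik
    · exact List.pairwise_iff_getElem.1 hsort i (k - 1) (by omega) hlt hik
    · obtain rfl : i = k - 1 := by omega
      exact le_rfl
  rw [h1]
  calc k = (L.take k).length := by rw [List.length_take]; omega
    _ = (L.take k).countP _ := h2.symm
    _ ≤ _ := (List.take_sublist k L).countP_le

lemma NkPlus_le (k : ℕ) (ts : List PTree) :
    NkPlus k (node ts) ≤ ts.length * Nk k (node ts) := by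
  set L := sortedSizesDesc (node ts) with hL
  have hNk : Nk k (node ts) = L.getD (k - 1) 0 := rfl
  have hNkP : NkPlus k (node ts) = (L.drop (k - 1)).sum := rfl
  have hsort : L.Pairwise (· ≥ ·) := List.pairwise_insertionSort _ _
  have hlen : L.length = ts.length := by
    rw [hL, sortedSizesDesc, List.length_insertionSort, childSizes, List.length_map]
  rw [hNk, hNkP]
  refine (List.sum_le_card_nsmul _ (L.getD (k - 1) 0) fun x hx => ?_).trans ?_
  · obtain ⟨i, hi, rfl⟩ := List.mem_iff_getElem.1 hx
    rw [List.length_drop] at hi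
    rw [List.getElem_drop, List.getD_eq_getElem _ _ (by omega)]
    rcases Nat.eq_zero_or_pos i with rfl | hi0
    · exact le_rfl
    · exact List.pairwise_iff_getElem.1 hsort (k - 1) (k - 1 + i) (by omega) (by omega) (by omega)
  · rw [smul_eq_mul, List.length_drop, hlen]
    gcongr
    omega

lemma NkPlus_le_size (k : ℕ) (T : PTree) : NkPlus k T ≤ T.size := by
  obtain ⟨ts⟩ := T
  have hperm : (sortedSizesDesc (node ts)).Perm (ts.map size) := List.perm_insertionSort _ _
  rw [NkPlus, size_node, ← hperm.sum_eq]
  exact ((List.drop_sublist _ _).sum_le_sum (by simp)).trans (by omega)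

lemma Nk_le_NkPlus (k : ℕ) (T : PTree) : Nk k T ≤ NkPlus k T := by
  rw [Nk, NkPlus]
  set L := sortedSizesDesc T
  rcases Nat.lt_or_ge (k - 1) L.length with h | h
  · rw [List.getD_eq_getElem _ _ h, List.drop_eq_getElem_cons h, List.sum_cons]
    omega
  · rw [List.getD_eq_default _ _ h]
    omega

variable {P : ℕ → ℝ≥0∞} {W : PTree → ℝ≥0∞}

/-- generating function of the trees with `t ≤ c * size` -/
noncomputable def largeGF (W : PTree → ℝ≥0∞) (t : ℝ) (c : ℕ) : PowerSeries ℝ≥0∞ :=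
  gradedGF size fun s => W s * if t ≤ (c : ℝ) * (s.size : ℝ) then 1 else 0

lemma coeff_largeGF (t : ℝ) (c n : ℕ) : PowerSeries.coeff n (largeGF W t c) =
    if t ≤ (c : ℝ) * (n : ℝ) then PowerSeries.coeff n (gradedGF size W) else 0 := by
  rw [largeGF, coeff_gradedGF, coeff_gradedGF]
  split_ifs with h
  · refine tsum_congr fun s => ?_
    by_cases hs : s.size = n
    · simp [hs, h]
    · simp [hs]
  · refine ENNReal.tsum_eq_zero.2 fun s => ?_
    by_cases hs : s.size = n
    · simp [hs, h]
    · simp [hs]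

lemma coeff_largeGF_le (t : ℝ) (c n : ℕ) :
    PowerSeries.coeff n (largeGF W t c) ≤ PowerSeries.coeff n (gradedGF size W) := by
  rw [coeff_largeGF]
  split_ifs
  · exact le_rfl
  · exact zero_le

lemma mass_largeGF_le {β : ℝ≥0∞} (hβ : DecayLe (gradedGF size W) β) {t : ℝ} (ht : 0 < t)
    {c : ℕ} (hc : c ≠ 0) : (largeGF W t c).mass ≤
      4 * β * (c : ℝ≥0∞) ^ (1 / 2 : ℝ) * ENNReal.ofReal t ^ (-(1 / 2) : ℝ) := by
  have hc' : (0 : ℝ) < c := by positivity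
  have h1 : ∀ n : ℕ, PowerSeries.coeff n (largeGF W t c) ≤
      β * if t / c ≤ n then (n : ℝ≥0∞) ^ (-(3 / 2) : ℝ) else 0 := by
    intro n
    rw [coeff_largeGF]
    by_cases h : t ≤ (c : ℝ) * (n : ℝ)
    · rw [if_pos h, if_pos (by rw [div_le_iff₀ hc']; linarith)]
      refine hβ n ?_
      rintro rfl
      simp at h
      linarith
    · rw [if_neg h]
      exact zero_le
  refine (ENNReal.tsum_le_tsum h1).trans ?_
  rw [ENNReal.tsum_mul_left]
  refine (mul_le_mul_right (tsum_natCast_rpow_tail_le (div_pos ht hc')) β).trans ?_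
  have e : ENNReal.ofReal (t / c) ^ (-(1 / 2) : ℝ) =
      (c : ℝ≥0∞) ^ (1 / 2 : ℝ) * ENNReal.ofReal t ^ (-(1 / 2) : ℝ) := by
    rw [ENNReal.ofReal_rpow_of_pos (by positivity), ENNReal.ofReal_rpow_of_pos ht,
      natCast_rpow_eq_ofReal hc, ← ENNReal.ofReal_mul (by positivity), Real.rpow_neg (by positivity),
      Real.rpow_neg (by positivity), Real.div_rpow (by positivity) (by positivity), inv_div,
      div_eq_mul_inv]
  rw [e]
  apply le_of_eq
  ring

lemma mass_largeGF_le_one (hW : ∀ ts, W (node ts) = P ts.length * (ts.map W).prod)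
    (hP : ∑' j, P j ≤ 1) (t : ℝ) (c : ℕ) : (largeGF W t c).mass ≤ 1 :=
  (ENNReal.tsum_le_tsum (coeff_largeGF_le t c)).trans (mass_sizeGF_le_one hW hP)

lemma coeff_succ_le_tsum_largeGF (hW : ∀ ts, W (node ts) = P ts.length * (ts.map W).prod)
    {k : ℕ} {c : ℕ → ℕ} {t : ℝ} {F : PTree → ℝ≥0∞}
    (hF : ∀ ts, F (node ts) ≤ listEsymm
      (fun s => if t ≤ (c ts.length : ℝ) * (s.size : ℝ) then 1 else 0) k ts) (m : ℕ) :
    PowerSeries.coeff (m + 1) (gradedGF size fun T => W T * F T) ≤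
      ∑' j, P j * (j.choose k * PowerSeries.coeff m
        (largeGF W t (c j) ^ k * gradedGF size W ^ (j - k))) := by
  rw [coeff_succ_gradedGF_size hW]
  refine ENNReal.tsum_le_tsum fun j => ?_
  gcongr
  rw [← coeff_C_mul_nat, largeGF, ← listGF_esymm, listGF, listGF, coeff_gradedGF, coeff_gradedGF]
  refine ENNReal.tsum_le_tsum fun l => ?_
  split_ifs with h1 h2
  · gcongr
    rw [← h2]
    exact hF l
  · exact le_rfl
  · exact le_rfl

lemma exists_marked_bounds (hW : ∀ ts, W (node ts) = P ts.length * (ts.map W).prod)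
    (hP : ∑' j, P j ≤ 1) {β : ℝ≥0∞} (hβ : β ≠ ⊤)
    (hdec : ∀ d : ℕ, DecayLe (gradedGF size W ^ d) (β * d)) (κ : ℕ) {c : ℕ → ℕ}
    (hc : ∀ j, j ≠ 0 → c j ≠ 0)
    (h1 : ∑' j : ℕ, P j * ((j : ℝ≥0∞) ^ (κ + 2) * ((c j : ℝ≥0∞) ^ (1 / 2 : ℝ)) ^ κ) ≠ ⊤)
    (h2 : ∑' j : ℕ, P j * ((j : ℝ≥0∞) ^ (κ + 1) * ((c j : ℝ≥0∞) ^ (1 / 2 : ℝ)) ^ (κ + 1)) ≠ ⊤) :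
    ∃ R : ℝ≥0∞, R ≠ ⊤ ∧ ∀ t : ℝ, 1 ≤ t → ∀ F : PTree → ℝ≥0∞,
      (∀ ts, F (node ts) ≤ listEsymm
        (fun s => if t ≤ (c ts.length : ℝ) * (s.size : ℝ) then 1 else 0) (κ + 1) ts) →
      (∀ T, (T.size : ℝ) < t → F T = 0) →
      (∀ n : ℕ, PowerSeries.coeff n (gradedGF size fun T => W T * F T) * n ≤
        R * (ENNReal.ofReal t ^ (-(1 / 2) : ℝ)) ^ (κ + 1)) ∧
      (gradedGF size fun T => W T * F T).mass ≤
        R * (ENNReal.ofReal t ^ (-(1 / 2) : ℝ)) ^ (κ + 1) := by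
  set S1 := ∑' j : ℕ, P j * ((j : ℝ≥0∞) ^ (κ + 2) * ((c j : ℝ≥0∞) ^ (1 / 2 : ℝ)) ^ κ)
  set S2 := ∑' j : ℕ, P j * ((j : ℝ≥0∞) ^ (κ + 1) * ((c j : ℝ≥0∞) ^ (1 / 2 : ℝ)) ^ (κ + 1))
  obtain ⟨A, hA, hpow⟩ := PowerSeries.exists_decayLe_pow κ
  set K : ℝ≥0∞ := 2 ^ (3 / 2 : ℝ) with hK
  have hKt : K ≠ ⊤ := ENNReal.rpow_ne_top_of_nonneg (by norm_num) (by simp)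
  have hY : DecayLe (gradedGF size W) β := by simpa using hdec 1
  have hYm := mass_sizeGF_le_one hW hP
  refine ⟨K * (K * ((A + 1) * β) * (4 * β) ^ κ * S1) + (4 * β) ^ (κ + 1) * S2, ?_, ?_⟩
  · have h4 : (4 * β) ≠ ⊤ := ENNReal.mul_ne_top (by simp) hβ
    have hA1 : A + 1 ≠ ⊤ := ENNReal.add_ne_top.2 ⟨hA, by simp⟩
    refine ENNReal.add_ne_top.2 ⟨ENNReal.mul_ne_top hKt (ENNReal.mul_ne_top (ENNReal.mul_ne_top
      (ENNReal.mul_ne_top hKt (ENNReal.mul_ne_top hA1 hβ)) (ENNReal.pow_ne_top h4)) h1),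
      ENNReal.mul_ne_top (ENNReal.pow_ne_top h4) h2⟩
  intro t ht F hF hF0
  set H := ENNReal.ofReal t ^ (-(1 / 2) : ℝ) with hH
  have ht0 : 0 < t := by linarith
  have hmass : ∀ j, j ≠ 0 → (largeGF W t (c j)).mass ≤
      4 * β * (c j : ℝ≥0∞) ^ (1 / 2 : ℝ) * H := fun j hj => mass_largeGF_le hY ht0 (hc j hj)
  have hchoose : ∀ j : ℕ, ((j.choose (κ + 1) : ℕ) : ℝ≥0∞) ≤ (j : ℝ≥0∞) ^ (κ + 1) := by
    intro j
    exact_mod_cast Nat.choose_le_pow j (κ + 1)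
  have hstep := coeff_succ_le_tsum_largeGF hW hF
  constructor
  · rintro (_ | m)
    · simp
    refine le_trans ?_ (mul_le_mul_left le_self_add _)
    rcases lt_or_ge ((m + 1 : ℕ) : ℝ) t with hmt | hmt
    · have : PowerSeries.coeff (m + 1) (gradedGF size fun T => W T * F T) = 0 := by
        rw [coeff_gradedGF]
        refine ENNReal.tsum_eq_zero.2 fun T => ?_
        split_ifs with hT
        · rw [hF0 T (by rwa [hT]), mul_zero]
        · rfl
      rw [this, zero_mul]
      exact zero_le
    rcases Nat.eq_zero_or_pos m with rfl | hm
    · have : PowerSeries.coeff (0 + 1) (gradedGF size fun T => W T * F T) = 0 := by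
        refine le_antisymm ((hstep 0).trans (le_of_eq ?_)) (zero_le)
        refine ENNReal.tsum_eq_zero.2 fun j => ?_
        have hz : PowerSeries.coeff 0 (largeGF W t (c j)) = 0 := coeff_zero_gradedGF_size _
        rw [PowerSeries.coeff_zero_eq_constantCoeff_apply] at hz
        rw [PowerSeries.coeff_zero_eq_constantCoeff_apply, map_mul, map_pow, hz]
        simp
      rw [this, zero_mul]
      exact zero_le
    have hcoef : PowerSeries.coeff (m + 1) (gradedGF size fun T => W T * F T) ≤
        (K * ((A + 1) * β) * (4 * β) ^ κ * S1) * H ^ κ * (m : ℝ≥0∞) ^ (-(3 / 2) : ℝ) := by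
      refine (hstep m).trans ?_
      rw [show (K * ((A + 1) * β) * (4 * β) ^ κ * S1) * H ^ κ * (m : ℝ≥0∞) ^ (-(3 / 2) : ℝ) =
        S1 * ((K * ((A + 1) * β) * (4 * β) ^ κ) * H ^ κ * (m : ℝ≥0∞) ^ (-(3 / 2) : ℝ)) by ring,
        ← ENNReal.tsum_mul_right]
      refine ENNReal.tsum_le_tsum fun j => ?_
      rcases Nat.eq_zero_or_pos j with rfl | hj
      · simp
      have hd := ((hpow _ β (fun n hn => (coeff_largeGF_le t (c j) n).trans (hY n hn))).mul
        (hdec (j - (κ + 1)))) m hm.ne'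
      rw [PowerSeries.mass_pow, PowerSeries.mass_pow, ← hK] at hd
      have hτ := hmass j hj.ne'
      have hτ1 := mass_largeGF_le_one hW hP t (c j)
      set τ := (largeGF W t (c j)).mass
      have hpow1 : τ ^ (κ + 1) ≤ τ ^ κ := by
        rw [pow_succ]
        exact mul_le_of_le_one_right' hτ1
      have hj1 : (1 : ℝ≥0∞) ≤ j := by exact_mod_cast hj
      calc P j * (j.choose (κ + 1) * PowerSeries.coeff m
            (largeGF W t (c j) ^ (κ + 1) * gradedGF size W ^ (j - (κ + 1))))
          ≤ P j * ((j : ℝ≥0∞) ^ (κ + 1) * (K * (A * β * τ ^ κ * (gradedGF size W).mass ^ (j - (κ + 1))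
              + β * ((j - (κ + 1) : ℕ) : ℝ≥0∞) * τ ^ (κ + 1)) *
              (m : ℝ≥0∞) ^ (-(3 / 2) : ℝ))) := by
            gcongr
            exact hchoose j
        _ ≤ P j * ((j : ℝ≥0∞) ^ (κ + 1) * (K * (A * β * τ ^ κ * j + β * j * τ ^ κ) *
              (m : ℝ≥0∞) ^ (-(3 / 2) : ℝ))) := by
            refine mul_le_mul_right (mul_le_mul_right (mul_le_mul_left (mul_le_mul_right
              (add_le_add ?_ (mul_le_mul' ?_ hpow1)) _) _) _) _
            · gcongr
              exact (pow_le_one' hYm _).trans hj1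
            · gcongr
              omega
        _ = P j * ((j : ℝ≥0∞) ^ (κ + 2) * (K * ((A + 1) * β) * τ ^ κ *
              (m : ℝ≥0∞) ^ (-(3 / 2) : ℝ))) := by ring
        _ ≤ P j * ((j : ℝ≥0∞) ^ (κ + 2) * (K * ((A + 1) * β) *
              (4 * β * (c j : ℝ≥0∞) ^ (1 / 2 : ℝ) * H) ^ κ *
              (m : ℝ≥0∞) ^ (-(3 / 2) : ℝ))) := by gcongr
        _ = _ := by rw [mul_pow, mul_pow (4 * β)]; ring
    have hm1 : ((m + 1 : ℕ) : ℝ≥0∞) ≠ 0 := by simp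
    have hm2 : ((m + 1 : ℕ) : ℝ≥0∞) ≠ ⊤ := ENNReal.natCast_ne_top _
    have hmH : (m : ℝ≥0∞) ^ (-(3 / 2) : ℝ) * (m + 1 : ℕ) ≤ K * H := by
      calc (m : ℝ≥0∞) ^ (-(3 / 2) : ℝ) * (m + 1 : ℕ)
          ≤ (K * ((m + 1 : ℕ) : ℝ≥0∞) ^ (-(3 / 2) : ℝ)) * (m + 1 : ℕ) := by
            gcongr
            exact natCast_rpow_neg_le (by norm_num) (by omega) (by omega)
        _ = K * ((m + 1 : ℕ) : ℝ≥0∞) ^ (-(1 / 2) : ℝ) := by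
            rw [mul_assoc]
            congr 1
            conv_lhs => rw [← ENNReal.rpow_one ((m + 1 : ℕ) : ℝ≥0∞), ← ENNReal.rpow_mul,
              ← ENNReal.rpow_add _ _ hm1 hm2]
            norm_num
        _ ≤ K * H := by
            gcongr
            rw [hH, ENNReal.rpow_neg, ENNReal.rpow_neg, ENNReal.inv_le_inv]
            refine ENNReal.rpow_le_rpow ?_ (by norm_num)
            rw [← ENNReal.ofReal_natCast]
            exact ENNReal.ofReal_le_ofReal hmt
    calc _ ≤ (K * ((A + 1) * β) * (4 * β) ^ κ * S1) * H ^ κ * (m : ℝ≥0∞) ^ (-(3 / 2) : ℝ) *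
          ((m + 1 : ℕ) : ℝ≥0∞) := by gcongr
      _ = (K * ((A + 1) * β) * (4 * β) ^ κ * S1) * H ^ κ * ((m : ℝ≥0∞) ^ (-(3 / 2) : ℝ) *
          ((m + 1 : ℕ) : ℝ≥0∞)) := by ring
      _ ≤ (K * ((A + 1) * β) * (4 * β) ^ κ * S1) * H ^ κ * (K * H) := by gcongr
      _ = _ := by ring
  · refine le_trans ?_ (mul_le_mul_left le_add_self _)
    rw [PowerSeries.mass, tsum_eq_zero_add' ENNReal.summable, coeff_zero_gradedGF_size, zero_add]
    refine (ENNReal.tsum_le_tsum hstep).trans ?_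
    rw [ENNReal.tsum_comm, show (4 * β) ^ (κ + 1) * S2 * H ^ (κ + 1) =
      S2 * ((4 * β) ^ (κ + 1) * H ^ (κ + 1)) by ring, ← ENNReal.tsum_mul_right]
    refine ENNReal.tsum_le_tsum fun j => ?_
    rcases Nat.eq_zero_or_pos j with rfl | hj
    · simp
    rw [ENNReal.tsum_mul_left, ENNReal.tsum_mul_left]
    change P j * (_ * PowerSeries.mass _) ≤ _
    rw [PowerSeries.mass_mul, PowerSeries.mass_pow, PowerSeries.mass_pow]
    have hτ := hmass j hj.ne'
    set τ := (largeGF W t (c j)).mass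
    calc _ ≤ P j * ((j : ℝ≥0∞) ^ (κ + 1) *
          ((4 * β * (c j : ℝ≥0∞) ^ (1 / 2 : ℝ) * H) ^ (κ + 1) * 1)) := by
          gcongr
          · exact hchoose j
          · exact pow_le_one' hYm _
      _ = _ := by rw [mul_pow, mul_pow (4 * β)]; ring

lemma exists_coeff_fringeSum_bound (hW : ∀ ts, W (node ts) = P ts.length * (ts.map W).prod)
    (hP : ∑' j, P j ≤ 1) {β : ℝ≥0∞} (hβ : β ≠ ⊤)
    (hdec : ∀ d : ℕ, DecayLe (gradedGF size W ^ d) (β * d)) (κ : ℕ) {c : ℕ → ℕ}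
    (hc : ∀ j, j ≠ 0 → c j ≠ 0)
    (h1 : ∑' j : ℕ, P j * ((j : ℝ≥0∞) ^ (κ + 2) * ((c j : ℝ≥0∞) ^ (1 / 2 : ℝ)) ^ κ) ≠ ⊤)
    (h2 : ∑' j : ℕ, P j * ((j : ℝ≥0∞) ^ (κ + 1) * ((c j : ℝ≥0∞) ^ (1 / 2 : ℝ)) ^ (κ + 1)) ≠ ⊤) :
    ∃ R : ℝ≥0∞, R ≠ ⊤ ∧ ∀ t : ℝ, 1 ≤ t → ∀ F : PTree → ℝ≥0∞,
      (∀ ts, F (node ts) ≤ listEsymm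
        (fun s => if t ≤ (c ts.length : ℝ) * (s.size : ℝ) then 1 else 0) (κ + 1) ts) →
      (∀ T, (T.size : ℝ) < t → F T = 0) → ∀ n : ℕ,
      P 0 * PowerSeries.coeff n (gradedGF size fun T => W T * fringeSum F T) ≤
        R * (ENNReal.ofReal t ^ (-(1 / 2) : ℝ)) ^ (κ + 1) * (n : ℝ≥0∞) ^ (-(1 / 2) : ℝ) := by
  obtain ⟨R, hR, h⟩ := exists_marked_bounds hW hP hβ hdec κ hc h1 h2
  refine ⟨(2 ^ (1 / 2 : ℝ) + 4) * (R * β), ENNReal.mul_ne_top (ENNReal.add_ne_top.2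
    ⟨ENNReal.rpow_ne_top_of_nonneg (by norm_num) (by simp), by simp⟩) (ENNReal.mul_ne_top hR hβ),
    fun t ht F hF hF0 n => ?_⟩
  obtain ⟨ha, hm⟩ := h t ht F hF hF0
  set H := (ENNReal.ofReal t ^ (-(1 / 2) : ℝ)) ^ (κ + 1)
  have hY : DecayLe (gradedGF size W) β := by simpa using hdec 1
  refine (mul_coeff_fringeSum_le hW F n).trans ?_
  refine (PowerSeries.sum_antidiagonal_mul_le (N := n + 1)
    (g := fun b => (b : ℝ≥0∞) * PowerSeries.coeff b (gradedGF size W)) (R := R * H) (α := β)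
    (by omega) ha hm (by simp) ?_).trans ?_
  · intro b hb
    have hb0 : (b : ℝ≥0∞) ≠ 0 := by simpa using hb
    have hbt : (b : ℝ≥0∞) ≠ ⊤ := ENNReal.natCast_ne_top _
    calc (b : ℝ≥0∞) * PowerSeries.coeff b (gradedGF size W)
        ≤ (b : ℝ≥0∞) * (β * (b : ℝ≥0∞) ^ (-(3 / 2) : ℝ)) := by gcongr; exact hY b hb
      _ = β * ((b : ℝ≥0∞) ^ (1 : ℝ) * (b : ℝ≥0∞) ^ (-(3 / 2) : ℝ)) := by
          rw [ENNReal.rpow_one]; ring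
      _ = _ := by rw [← ENNReal.rpow_add _ _ hb0 hbt]; norm_num
  · calc _ = (2 ^ (1 / 2 : ℝ) + 4) * (R * β) * H * ((n + 1 : ℕ) : ℝ≥0∞) ^ (-(1 / 2) : ℝ) := by ring
      _ ≤ _ := by
        refine mul_le_mul' le_rfl ?_
        rw [ENNReal.rpow_neg, ENNReal.rpow_neg, ENNReal.inv_le_inv]
        exact ENNReal.rpow_le_rpow (by simp) (by norm_num)

end PTree

end FringeTail

section ConditionedTree

open scoped ENNReal

namespace PTree

open PowerSeries (DecayLe)

variable {p : ℕ → ℝ}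

lemma weight_nonneg (h0 : ∀ i, 0 ≤ p i) (T : PTree) : 0 ≤ weight p T := by
  induction T using induction_on with
  | h ts ih =>
    rw [weight_node]
    refine mul_nonneg (h0 _) (List.prod_nonneg fun x hx => ?_)
    obtain ⟨s, hs, rfl⟩ := List.mem_map.1 hx
    exact ih s hs

/-- the weight of a tree as an extended nonnegative real -/
noncomputable def eweight (p : ℕ → ℝ) (T : PTree) : ℝ≥0∞ := ENNReal.ofReal (weight p T)

lemma eweight_node (h0 : ∀ i, 0 ≤ p i) (ts : List PTree) : eweight p (node ts) =
    ENNReal.ofReal (p ts.length) * (ts.map (eweight p)).prod := by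
  rw [eweight, weight_node, ENNReal.ofReal_mul (h0 _)]
  congr 1
  induction ts with
  | nil => simp
  | cons s ts ih =>
    rw [List.map_cons, List.prod_cons, ENNReal.ofReal_mul (weight_nonneg h0 s), ih,
      List.map_cons, List.prod_cons, eweight]

lemma tsum_subtype_weight (h0 : ∀ i, 0 ≤ p i) (Q : PTree → Prop) [DecidablePred Q] :
    ∑' T : {T : PTree // Q T}, weight p T.1 =
      (∑' T, if Q T then eweight p T else 0).toReal := by
  rw [ENNReal.tsum_toReal_eq]
  · refine (tsum_subtype {T | Q T} (weight p)).trans (tsum_congr fun T => ?_)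
    by_cases hT : Q T
    · simp [hT, eweight, ENNReal.toReal_ofReal (weight_nonneg h0 T)]
    · simp [hT]
  · intro T
    split_ifs <;> simp [eweight]

lemma coeff_mk_ofReal_pow (h0 : ∀ i, 0 ≤ p i) (m r : ℕ) :
    PowerSeries.coeff r (PowerSeries.mk (fun i => ENNReal.ofReal (p i)) ^ m) =
      ENNReal.ofReal (PowerSeries.coeff r (PowerSeries.mk p ^ m)) := by
  induction m generalizing r with
  | zero =>
    rw [pow_zero, pow_zero, PowerSeries.coeff_one, PowerSeries.coeff_one]
    split_ifs <;> simp
  | succ m ih =>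
    rw [pow_succ, pow_succ, PowerSeries.coeff_mul, PowerSeries.coeff_mul,
      ENNReal.ofReal_sum_of_nonneg]
    · refine Finset.sum_congr rfl fun x _ => ?_
      rw [ih, ENNReal.ofReal_mul (coeff_mk_pow_nonneg h0 _ _), PowerSeries.coeff_mk,
        PowerSeries.coeff_mk]
    · intro x _
      rw [PowerSeries.coeff_mk]
      exact mul_nonneg (coeff_mk_pow_nonneg h0 _ _) (h0 _)

lemma tsum_ofReal_eq_one (h0 : ∀ i, 0 ≤ p i) (h1 : ∑' i, p i = 1) :
    ∑' i, ENNReal.ofReal (p i) = 1 := by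
  rw [← ENNReal.ofReal_tsum_of_nonneg h0 (summable_of_tsum_eq_one h1), h1, ENNReal.ofReal_one]

lemma offspring_zero_ne_zero (h0 : ∀ i, 0 ≤ p i) (h1 : ∑' i, p i = 1)
    (hmean : ∑' i : ℕ, (i : ℝ) * p i = 1) (hvar : 1 < ∑' i : ℕ, (i : ℝ) ^ 2 * p i) :
    p 0 ≠ 0 := by
  intro hp0
  have hs := summable_of_tsum_eq_one h1
  have hm := summable_of_tsum_eq_one hmean
  have hnn : ∀ i : ℕ, 0 ≤ (i : ℝ) * p i - p i := by
    rintro (_ | i)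
    · simp [hp0]
    · push_cast
      nlinarith [h0 (i + 1), (Nat.cast_nonneg i : (0 : ℝ) ≤ i)]
  have hz : ∑' i : ℕ, ((i : ℝ) * p i - p i) = 0 := by
    rw [hm.tsum_sub hs, hmean, h1, sub_self]
  have hall := (hasSum_zero_iff_of_nonneg hnn).1 (hz ▸ (hm.sub hs).hasSum)
  have : ∀ i : ℕ, (i : ℝ) ^ 2 * p i = p i := by
    intro i
    have h2 := congrFun hall i
    simp only [Pi.zero_apply] at h2
    linear_combination ((i : ℝ) + 1) * h2
  simp_rw [this, h1] at hvar
  exact lt_irrefl _ hvar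

lemma one_le_fringeSum {F : PTree → ℝ≥0∞} {s T : PTree} (hs : s ∈ T.subtrees) (h : 1 ≤ F s) :
    1 ≤ fringeSum F T :=
  h.trans (List.single_le_sum (fun _ _ => zero_le) _ (List.mem_map_of_mem hs))

lemma exists_le_of_le_foldr_max {α : Type*} {f : α → ℕ} {l : List α} {t : ℝ} (ht : 0 < t)
    (h : t ≤ ((l.map f).foldr max 0 : ℕ)) : ∃ a ∈ l, t ≤ f a := by
  induction l with
  | nil =>
    simp at h
    linarith
  | cons a l ih =>
    rw [List.map_cons, List.foldr_cons, Nat.cast_max, le_max_iff] at h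
    rcases h with h | h
    · exact ⟨a, List.mem_cons_self, h⟩
    · obtain ⟨b, hb, hb'⟩ := ih h
      exact ⟨b, List.mem_cons_of_mem _ hb, hb'⟩

lemma decayLe_pow (h0 : ∀ i, 0 ≤ p i) {C : ℝ}
    (hC : ∀ m r : ℕ, PowerSeries.coeff r (PowerSeries.mk p ^ m) * √m ≤ C) (d : ℕ) :
    DecayLe (gradedGF size (eweight p) ^ d) (ENNReal.ofReal C * d) := by
  intro n hn
  rcases lt_or_ge n d with h | h
  · rw [coeff_sizeGF_pow_of_lt h]
    exact zero_le
  · obtain ⟨r, rfl⟩ : ∃ r, n = r + d := ⟨n - d, by omega⟩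
    have hcl := cycle_lemma (P := fun i => ENNReal.ofReal (p i)) (eweight_node h0) d r
    rw [coeff_mk_ofReal_pow h0] at hcl
    set m := r + d
    have hm0 : (m : ℝ≥0∞) ≠ 0 := by simpa using hn
    have hmt : (m : ℝ≥0∞) ≠ ⊤ := ENNReal.natCast_ne_top _
    refine (ENNReal.mul_le_mul_iff_right hm0 hmt).1 ?_
    rw [hcl]
    have h1 : ENNReal.ofReal (PowerSeries.coeff r (PowerSeries.mk p ^ m)) ≤
        ENNReal.ofReal C * (m : ℝ≥0∞) ^ (-(1 / 2) : ℝ) := by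
      have hmp : (0 : ℝ) < √m := Real.sqrt_pos.2 (by positivity)
      rw [natCast_rpow_eq_ofReal hn, ← ENNReal.ofReal_mul' (by positivity),
        Real.rpow_neg (by positivity), ← Real.sqrt_eq_rpow, ← div_eq_mul_inv]
      exact ENNReal.ofReal_le_ofReal ((le_div_iff₀ hmp).2 (hC m r))
    calc (d : ℝ≥0∞) * ENNReal.ofReal (PowerSeries.coeff r (PowerSeries.mk p ^ m))
        ≤ d * (ENNReal.ofReal C * (m : ℝ≥0∞) ^ (-(1 / 2) : ℝ)) := by gcongr
      _ = d * (ENNReal.ofReal C * ((m : ℝ≥0∞) ^ (1 : ℝ) * (m : ℝ≥0∞) ^ (-(3 / 2) : ℝ))) := by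
          rw [← ENNReal.rpow_add _ _ hm0 hmt]
          norm_num
      _ = _ := by rw [ENNReal.rpow_one]; ring

lemma treeSum_eq (h0 : ∀ i, 0 ≤ p i) (n : ℕ) :
    treeSum p n = (PowerSeries.coeff n (gradedGF size (eweight p))).toReal := by
  rw [treeSum, tsum_subtype_weight h0 fun T => T.size = n, coeff_gradedGF]

lemma rpow_neg_half_le_of_mem_gwSupport (h0 : ∀ i, 0 ≤ p i) {c : ℝ}
    (hc : ∀ m : ℕ, 0 < PowerSeries.coeff m (PowerSeries.mk p ^ (m + 1)) →
      c ≤ PowerSeries.coeff m (PowerSeries.mk p ^ (m + 1)) * √(m + 1 : ℕ)) {n : ℕ}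
    (hn : n ∈ gwSupport p) : ENNReal.ofReal c * (n : ℝ≥0∞) ^ (-(1 / 2) : ℝ) ≤
      n * PowerSeries.coeff n (gradedGF size (eweight p)) := by
  obtain ⟨hn1, hpos⟩ := hn
  obtain ⟨m, rfl⟩ : ∃ m, n = m + 1 := ⟨n - 1, by omega⟩
  have hcl := cycle_lemma (P := fun i => ENNReal.ofReal (p i)) (eweight_node h0) 1 m
  rw [coeff_mk_ofReal_pow h0, pow_one, Nat.cast_one, one_mul] at hcl
  rw [treeSum_eq h0] at hpos
  have hpos' := (ENNReal.toReal_pos_iff.1 hpos).1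
  rw [hcl, natCast_rpow_eq_ofReal (by omega), ← ENNReal.ofReal_mul' (by positivity)]
  refine ENNReal.ofReal_le_ofReal ?_
  have hmp : (0 : ℝ) < √((m + 1 : ℕ) : ℝ) := Real.sqrt_pos.2 (by positivity)
  rw [Real.rpow_neg (by positivity), ← Real.sqrt_eq_rpow, ← div_eq_mul_inv, div_le_iff₀ hmp]
  refine hc m ?_
  rw [← ENNReal.ofReal_pos, ← hcl]
  exact ENNReal.mul_pos (by simp) hpos'.ne'

lemma tsum_moment_ne_top {f : ℕ → ℝ} (hf : Summable fun j => f j * p j) {g : ℕ → ℝ≥0∞}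
    (h0 : ∀ i, 0 ≤ p i) (hg : ∀ j, g j ≤ ENNReal.ofReal (f j)) :
    ∑' j, ENNReal.ofReal (p j) * g j ≠ ⊤ := by
  refine ne_top_of_le_ne_top hf.tsum_ofReal_ne_top (ENNReal.tsum_le_tsum fun j => ?_)
  rw [ENNReal.ofReal_mul' (h0 j), mul_comm]
  gcongr
  exact hg j

theorem exists_condProb_foldr_max_le (h0 : ∀ i, 0 ≤ p i) (h1 : ∑' i, p i = 1)
    (hmean : ∑' i : ℕ, (i : ℝ) * p i = 1) (hsq : Summable fun i : ℕ => (i : ℝ) ^ 2 * p i)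
    (hvar : 1 < ∑' i : ℕ, (i : ℝ) ^ 2 * p i) {k : ℕ} (hk : k ≠ 0) {c : ℕ → ℕ}
    (hc : ∀ j, j ≠ 0 → c j ≠ 0) (hcj : ∀ j, j ≠ 0 → c j ≤ j)
    (hmom : Summable fun j : ℕ => (j : ℝ) ^ (k + 1) * √(c j) ^ (k - 1) * p j)
    {f : PTree → ℕ} (hfs : ∀ T, f T ≤ T.size)
    (hf : ∀ ts, 0 < f (node ts) →
      k ≤ ts.countP fun s => f (node ts) ≤ c ts.length * s.size) :
    ∃ C : ℝ, 0 < C ∧ ∀ n ∈ gwSupport p, ∀ t : ℝ, 1 ≤ t →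
      condProb p n (fun T => t ≤ ((T.subtrees.map f).foldr max 0 : ℕ)) ≤
        C * n * t ^ (-(k : ℝ) / 2) := by
  classical
  obtain ⟨κ, rfl⟩ : ∃ κ, k = κ + 1 := ⟨k - 1, by omega⟩
  have hp0 := offspring_zero_ne_zero h0 h1 hmean hvar
  obtain ⟨⟨Cu, -, hCu⟩, cl, hcl0, hcl⟩ := local_limit_bounds h0 h1 hmean hsq hvar hp0
  have hsqrt : ∀ j, ((c j : ℝ≥0∞)) ^ (1 / 2 : ℝ) = ENNReal.ofReal √(c j) := by
    intro j
    rw [Real.sqrt_eq_rpow, ← ENNReal.ofReal_rpow_of_nonneg (by positivity) (by norm_num),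
      ENNReal.ofReal_natCast]
  obtain ⟨R, hR, hbound⟩ := exists_coeff_fringeSum_bound (eweight_node h0)
    (tsum_ofReal_eq_one h0 h1).le ENNReal.ofReal_ne_top (decayLe_pow h0 hCu) κ hc
    (tsum_moment_ne_top hmom h0 fun j => by
      rw [hsqrt, ENNReal.ofReal_mul (by positivity), ENNReal.ofReal_pow (by positivity),
        ENNReal.ofReal_pow (by positivity), ENNReal.ofReal_natCast]
      rfl)
    (tsum_moment_ne_top hmom h0 fun j => by
      rcases Nat.eq_zero_or_pos j with rfl | hj
      · simp
      · rw [hsqrt, ← ENNReal.ofReal_natCast, ← ENNReal.ofReal_pow (by positivity),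
          ← ENNReal.ofReal_pow (by positivity), ← ENNReal.ofReal_mul (by positivity)]
        refine ENNReal.ofReal_le_ofReal ?_
        have hle : √(c j) ≤ (j : ℝ) := by
          rw [Real.sqrt_le_left (by positivity)]
          calc (c j : ℝ) ≤ j := by exact_mod_cast hcj j hj.ne'
            _ ≤ (j : ℝ) ^ 2 := by exact_mod_cast Nat.le_self_pow two_ne_zero j
        rw [Nat.add_sub_cancel, pow_succ (√(c j)), pow_succ (j : ℝ) (κ + 1)]
        calc (j : ℝ) ^ (κ + 1) * (√(c j) ^ κ * √(c j))
            ≤ (j : ℝ) ^ (κ + 1) * (√(c j) ^ κ * j) := by gcongr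
          _ = _ := by ring)
  have hp0' : 0 < p 0 := lt_of_le_of_ne (h0 0) hp0.symm
  set D : ℝ := R.toReal / (p 0 * cl) with hD
  refine ⟨D + 1, by positivity, fun n hn t ht => ?_⟩
  have ht0 : 0 < t := by linarith
  have hH : (ENNReal.ofReal t ^ (-(1 / 2) : ℝ)) ^ (κ + 1) =
      ENNReal.ofReal (t ^ (-((κ + 1 : ℕ) : ℝ) / 2)) := by
    rw [ENNReal.ofReal_rpow_of_pos ht0, ← ENNReal.ofReal_pow (by positivity),
      ← Real.rpow_natCast, ← Real.rpow_mul ht0.le]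
    congr 2
    ring
  have hQ := hbound t ht (fun T => if t ≤ f T then 1 else 0) (fun ts => ?_) (fun T hT => ?_) n
  · set Y := gradedGF size (eweight p)
    set M := PowerSeries.coeff n (gradedGF size fun T => eweight p T *
      fringeSum (fun T => if t ≤ f T then 1 else 0) T) with hM
    have hnum : ∑' T : {T : PTree // T.size = n ∧ t ≤ ((T.subtrees.map f).foldr max 0 : ℕ)},
        weight p T.1 = (∑' T, if T.size = n ∧ t ≤ ((T.subtrees.map f).foldr max 0 : ℕ) then
          eweight p T else 0).toReal := tsum_subtype_weight h0 _
    have hle : (∑' T, if T.size = n ∧ t ≤ ((T.subtrees.map f).foldr max 0 : ℕ) then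
          eweight p T else 0) ≤ M := by
      rw [hM, coeff_gradedGF]
      refine ENNReal.tsum_le_tsum fun T => ?_
      split_ifs with ha hb hb
      · obtain ⟨s, hs, hts⟩ := exists_le_of_le_foldr_max ht0 ha.2
        exact le_mul_of_one_le_right' (one_le_fringeSum hs (by rw [if_pos hts]))
      · exact absurd ha.1 hb
      · exact zero_le
      · exact zero_le
    set N := ∑' T, if T.size = n ∧ t ≤ ((T.subtrees.map f).foldr max 0 : ℕ) then
          eweight p T else 0
    have hY1 : PowerSeries.coeff n Y ≠ ⊤ := by
      refine ne_top_of_le_ne_top ENNReal.one_ne_top (le_trans ?_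
        (mass_sizeGF_le_one (eweight_node h0) (tsum_ofReal_eq_one h0 h1).le))
      exact ENNReal.le_tsum n
    have hmain : ENNReal.ofReal cl * (ENNReal.ofReal (p 0) * N) ≤
        R * ENNReal.ofReal (t ^ (-((κ + 1 : ℕ) : ℝ) / 2)) * (n * PowerSeries.coeff n Y) := by
      calc _ ≤ ENNReal.ofReal cl * (ENNReal.ofReal (p 0) * M) := by gcongr
        _ ≤ ENNReal.ofReal cl * (R * ENNReal.ofReal (t ^ (-((κ + 1 : ℕ) : ℝ) / 2)) *
            (n : ℝ≥0∞) ^ (-(1 / 2) : ℝ)) := by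
          rw [← hH]
          gcongr
        _ = R * ENNReal.ofReal (t ^ (-((κ + 1 : ℕ) : ℝ) / 2)) *
            (ENNReal.ofReal cl * (n : ℝ≥0∞) ^ (-(1 / 2) : ℝ)) := by ring
        _ ≤ _ := by
          refine mul_le_mul_right ?_ _
          exact rpow_neg_half_le_of_mem_gwSupport h0 hcl hn
    have hreal := ENNReal.toReal_mono (ENNReal.mul_ne_top (ENNReal.mul_ne_top hR
      ENNReal.ofReal_ne_top) (ENNReal.mul_ne_top (ENNReal.natCast_ne_top n) hY1)) hmain
    simp only [ENNReal.toReal_mul, ENNReal.toReal_natCast] at hreal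
    rw [ENNReal.toReal_ofReal hcl0.le, ENNReal.toReal_ofReal hp0'.le,
      ENNReal.toReal_ofReal (by positivity), ← treeSum_eq h0] at hreal
    rw [condProb, hnum, div_le_iff₀ hn.2]
    have hX : 0 ≤ t ^ (-((κ + 1 : ℕ) : ℝ) / 2) * (n * treeSum p n) := by
      have := hn.2
      positivity
    have hR' : R.toReal = D * (p 0 * cl) := by
      rw [hD]
      field_simp
    rw [hR'] at hreal
    have h3 : (p 0 * cl) * N.toReal ≤
        (p 0 * cl) * (D * (t ^ (-((κ + 1 : ℕ) : ℝ) / 2) * (n * treeSum p n))) := by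
      linarith
    have h4 := le_of_mul_le_mul_left h3 (by positivity)
    linarith
  · split_ifs with h
    · refine one_le_listEsymm _ _ _ ((hf ts ?_).trans (List.countP_mono_left fun s _ hs => ?_))
      · exact_mod_cast ht0.trans_le h
      · rw [decide_eq_true_eq] at hs ⊢
        exact h.trans (by exact_mod_cast hs)
    · exact zero_le
  · refine if_neg (not_le.2 (lt_of_le_of_lt ?_ hT))
    exact_mod_cast hfs T

end PTree

end ConditionedTree

/-- tail bound for the maximum of `N_k` (resp. `N_{k+}`) over all
nodes of `τ_n`. -/
theorem stmt_13 (p : ℕ → ℝ)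
    (hp_nonneg : ∀ i, 0 ≤ p i)
    (hp_sum : ∑' i : ℕ, p i = 1)
    (hp_mean : ∑' i : ℕ, (i : ℝ) * p i = 1)
    (hp_sq : Summable (fun i : ℕ => (i : ℝ) ^ 2 * p i))
    (hp_var : 1 < ∑' i : ℕ, (i : ℝ) ^ 2 * p i)
    (k : ℕ) (hk : 2 ≤ k) :
    (MomentFinite p ((k : ℝ) + 1) →
      ∃ C : ℝ, 0 < C ∧ ∀ n ∈ gwSupport p, ∀ t : ℝ, 1 ≤ t →
        condProb p n (fun T => t ≤ (maxNk k T : ℝ)) ≤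
          C * (n : ℝ) * t ^ (-(k : ℝ) / 2))
    ∧ (MomentFinite p ((3 * (k : ℝ) + 1) / 2) →
        ∃ C : ℝ, 0 < C ∧ ∀ n ∈ gwSupport p, ∀ t : ℝ, 1 ≤ t →
          condProb p n (fun T => t ≤ (maxNkPlus k T : ℝ)) ≤
            C * (n : ℝ) * t ^ (-(k : ℝ) / 2)) := by
  constructor
  · intro hm
    refine PTree.exists_condProb_foldr_max_le hp_nonneg hp_sum hp_mean hp_sq hp_var
      (by omega) (c := fun _ => 1) (by simp) (fun j hj => Nat.one_le_iff_ne_zero.2 hj) ?_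
      (fun T => (PTree.Nk_le_NkPlus k T).trans (PTree.NkPlus_le_size k T)) fun ts h => ?_
    · refine hm.congr fun j => ?_
      rw [Nat.cast_one, Real.sqrt_one, one_pow, mul_one, ← Real.rpow_natCast]
      push_cast
      rfl
    · simp only [one_mul]
      exact PTree.le_countP_Nk h
  · intro hm
    refine PTree.exists_condProb_foldr_max_le hp_nonneg hp_sum hp_mean hp_sq hp_var
      (by omega) (c := fun j => j) (fun j hj => hj) (fun j _ => le_rfl) ?_
      (PTree.NkPlus_le_size k) fun ts h => ?_
    · refine hm.congr fun j => ?_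
      rcases Nat.eq_zero_or_pos j with rfl | hj
      · rw [Nat.cast_zero, zero_pow (by omega), Real.zero_rpow (by positivity), zero_mul, zero_mul,
          zero_mul]
      · have hj' : (0 : ℝ) < j := by positivity
        rw [Real.sqrt_eq_rpow, ← Real.rpow_natCast, ← Real.rpow_natCast, ← Real.rpow_mul hj'.le,
          ← Real.rpow_add hj', Nat.cast_sub (by omega)]
        congr 2
        push_cast
        ring
    · have hle := PTree.NkPlus_le k ts
      have hpos : 0 < PTree.Nk k (PTree.node ts) := Nat.pos_of_mul_pos_left (h.trans_le hle)
      refine (PTree.le_countP_Nk hpos).trans (List.countP_mono_left fun s _ hs => ?_)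
      rw [decide_eq_true_eq] at hs ⊢
      exact hle.trans (Nat.mul_le_mul_left _ hs)
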